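/- arXiv:1712.07303 — 7 statements merged into one kernel-verified Lean document; each statement's English description precedes it below -/
import Mathlib

section
/- Let F be a field of characteristic ≠ 2 and let A be an associative F-algebra generated (as an associative algebra) by a finite collection of nilpotent elements. Then for every i ≥ 1, the i-th Lie derived power A^{[i]} is a finitely generated Lie algebra. -/
/-- `nuPow a n = a ^ (n + 1)` in a non-unital ring. -/
def nuPow {A : Type*} [NonUnitalRing A] (a : A) : ℕ → A
  | 0 => a
  | n + 1 => a * nuPow a n

/-- The linear span of all commutators `u * v - v * u` with `u ∈ U`, `v ∈ V`. -/
def commSpan (F : Type*) [Field F] {A : Type*} [NonUnitalRing A] [Module F A]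
    [SMulCommClass F A A] [IsScalarTower F A A] (U V : Submodule F A) : Submodule F A :=
  Submodule.span F {x | ∃ u ∈ U, ∃ v ∈ V, x = u * v - v * u}

/-- The Lie derived powers `A^{[0]} = A`, `A^{[i+1]} = [A^{[i]}, A^{[i]}]`. -/
def derivedPower (F : Type*) [Field F] (A : Type*) [NonUnitalRing A] [Module F A]
    [SMulCommClass F A A] [IsScalarTower F A A] : ℕ → Submodule F A
  | 0 => ⊤
  | i + 1 => commSpan F (derivedPower F A i) (derivedPower F A i)

/-- The associative (non-unital) subalgebra generated by `S`: the smallest subspace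
containing `S` that is closed under multiplication. -/
def algClosure (F : Type*) [Field F] {A : Type*} [NonUnitalRing A] [Module F A]
    [SMulCommClass F A A] [IsScalarTower F A A] (S : Set A) : Submodule F A :=
  sInf {p : Submodule F A | S ⊆ ↑p ∧ ∀ x ∈ p, ∀ y ∈ p, x * y ∈ p}

/-- The Lie subalgebra of `A⁽⁻⁾` generated by `S`: the smallest subspace containing `S`
that is closed under the commutator bracket. -/
def lieClosure (F : Type*) [Field F] {A : Type*} [NonUnitalRing A] [Module F A]
    [SMulCommClass F A A] [IsScalarTower F A A] (S : Set A) : Submodule F A :=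
  sInf {p : Submodule F A | S ⊆ ↑p ∧ ∀ x ∈ p, ∀ y ∈ p, x * y - y * x ∈ p}

section Commutators

variable {F : Type*} [Field F] {A : Type*} [NonUnitalRing A] [Module F A]
  [SMulCommClass F A A] [IsScalarTower F A A]

theorem commutator_mem_commSpan {U V : Submodule F A} {u v : A} (hu : u ∈ U) (hv : v ∈ V) :
    u * v - v * u ∈ commSpan F U V :=
  Submodule.subset_span ⟨u, hu, v, hv, rfl⟩

theorem commSpan_le {U V P : Submodule F A} :
    commSpan F U V ≤ P ↔ ∀ u ∈ U, ∀ v ∈ V, u * v - v * u ∈ P := by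
  refine ⟨fun h u hu v hv => h (commutator_mem_commSpan hu hv), fun h => ?_⟩
  refine Submodule.span_le.2 ?_
  rintro _ ⟨u, hu, v, hv, rfl⟩
  exact h u hu v hv

theorem commSpan_mono {U U' V V' : Submodule F A} (hU : U ≤ U') (hV : V ≤ V') :
    commSpan F U V ≤ commSpan F U' V' :=
  commSpan_le.2 fun _ hu _ hv => commutator_mem_commSpan (hU hu) (hV hv)

theorem derivedPower_succ_le (i : ℕ) : derivedPower F A (i + 1) ≤ derivedPower F A i := by
  induction i with
  | zero => exact le_top
  | succ i ih => exact commSpan_mono ih ih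

theorem commutator_mem_derivedPower {i : ℕ} {x y : A} (hx : x ∈ derivedPower F A i)
    (hy : y ∈ derivedPower F A i) : x * y - y * x ∈ derivedPower F A i :=
  derivedPower_succ_le i (commutator_mem_commSpan hx hy)

theorem subset_lieClosure (S : Set A) : S ⊆ lieClosure F S := by
  intro x hx
  exact (Submodule.mem_sInf).2 fun p hp => hp.1 hx

theorem commutator_mem_lieClosure {S : Set A} {x y : A} (hx : x ∈ lieClosure F S)
    (hy : y ∈ lieClosure F S) : x * y - y * x ∈ lieClosure F S :=
  (Submodule.mem_sInf).2 fun p hp =>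
    hp.2 x (Submodule.mem_sInf.1 hx p hp) y (Submodule.mem_sInf.1 hy p hp)

theorem lieClosure_le_derivedPower {S : Set A} {i : ℕ} (h : S ⊆ derivedPower F A i) :
    lieClosure F S ≤ derivedPower F A i :=
  sInf_le ⟨h, fun _ hx _ hy => commutator_mem_derivedPower hx hy⟩

end Commutators

section Graded

variable {F : Type*} [Field F] {R : Type*} [Ring R] [Algebra F R]

theorem mul_mem_pow {V : Submodule F R} {p q n : ℕ} {a b : R} (ha : a ∈ V ^ p) (hb : b ∈ V ^ q)
    (h : p + q = n) : a * b ∈ V ^ n := by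
  subst h
  rw [pow_add]
  exact Submodule.mul_mem_mul ha hb

theorem one_mem_pow_zero {V : Submodule F R} : (1 : R) ∈ V ^ 0 := by
  rw [pow_zero]
  exact Submodule.one_le.1 le_rfl

/-- The Lie derived powers of the family `V, V ^ 2, V ^ 3, …`, computed degree by degree. -/
def gradedDerived (V : Submodule F R) : ℕ → ℕ → Submodule F R
  | 0, 0 => ⊥
  | 0, d + 1 => V ^ (d + 1)
  | i + 1, d => ⨆ p ∈ Finset.HasAntidiagonal.antidiagonal d,
      commSpan F (gradedDerived V i p.1) (gradedDerived V i p.2)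

theorem gradedDerived_succ_le {V : Submodule F R} {i d : ℕ} {P : Submodule F R} :
    gradedDerived V (i + 1) d ≤ P ↔ ∀ p q, p + q = d → ∀ u ∈ gradedDerived V i p,
      ∀ v ∈ gradedDerived V i q, u * v - v * u ∈ P := by
  simp only [gradedDerived, iSup_le_iff, commSpan_le, Finset.HasAntidiagonal.mem_antidiagonal, Prod.forall]

theorem commutator_mem_gradedDerived_succ {V : Submodule F R} {i p q d : ℕ} (h : p + q = d)
    {u v : R} (hu : u ∈ gradedDerived V i p) (hv : v ∈ gradedDerived V i q) :
    u * v - v * u ∈ gradedDerived V (i + 1) d :=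
  gradedDerived_succ_le.1 le_rfl p q h u hu v hv

theorem gradedDerived_degree_zero (V : Submodule F R) (i : ℕ) : gradedDerived V i 0 = ⊥ := by
  induction i with
  | zero => rfl
  | succ i ih =>
    rw [eq_bot_iff, gradedDerived_succ_le]
    intro p q h u hu v hv
    obtain rfl : p = 0 := by omega
    rw [ih, Submodule.mem_bot] at hu
    simp [hu]

theorem gradedDerived_le_pow (V : Submodule F R) (i d : ℕ) : gradedDerived V i d ≤ V ^ d := by
  induction i generalizing d with
  | zero => cases d with
    | zero => exact bot_le
    | succ d => exact le_rfl
  | succ i ih =>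
    rw [gradedDerived_succ_le]
    intro p q h u hu v hv
    exact sub_mem (mul_mem_pow (ih _ hu) (ih _ hv) h)
      (mul_mem_pow (ih _ hv) (ih _ hu) (by omega))

theorem gradedDerived_succ_le_self (V : Submodule F R) (i d : ℕ) :
    gradedDerived V (i + 1) d ≤ gradedDerived V i d := by
  induction i generalizing d with
  | zero =>
    cases d with
    | zero => rw [gradedDerived_degree_zero]; exact bot_le
    | succ d => exact gradedDerived_le_pow V 1 (d + 1)
  | succ i ih =>
    rw [gradedDerived_succ_le]
    intro p q h u hu v hv
    exact commutator_mem_gradedDerived_succ h (ih _ hu) (ih _ hv)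

theorem gradedDerived_le_one (V : Submodule F R) {i : ℕ} (hi : 1 ≤ i) (d : ℕ) :
    gradedDerived V i d ≤ gradedDerived V 1 d := by
  induction i, hi using Nat.le_induction with
  | base => exact le_rfl
  | succ i _ ih => exact (gradedDerived_succ_le_self V i d).trans ih

/-- Each graded derived power is a Lie ideal. -/
theorem commutator_mem_gradedDerived {V : Submodule F R} {i p q n : ℕ} (h : p + q = n)
    {u a : R} (hu : u ∈ gradedDerived V i p) (ha : a ∈ V ^ q) :
    u * a - a * u ∈ gradedDerived V i n := by
  induction i generalizing p n u with
  | zero =>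
    cases p with
    | zero =>
      rw [gradedDerived_degree_zero, Submodule.mem_bot] at hu
      simp [hu]
    | succ p =>
      obtain ⟨n, rfl⟩ : ∃ m, n = m + 1 := ⟨p + q, by omega⟩
      have hu' : u ∈ V ^ (p + 1) := hu
      exact sub_mem (mul_mem_pow hu' ha h) (mul_mem_pow ha hu' (by omega))
  | succ i ih =>
    have key : gradedDerived V (i + 1) p ≤ (gradedDerived V (i + 1) n).comap
        (LinearMap.mulRight F a - LinearMap.mulLeft F a) := by
      rw [gradedDerived_succ_le]
      intro r s hrs x hx y hy
      have e : (LinearMap.mulRight F a - LinearMap.mulLeft F a) (x * y - y * x) =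
          (x * (y * a - a * y) - (y * a - a * y) * x) +
          ((x * a - a * x) * y - y * (x * a - a * x)) := by
        simp only [LinearMap.sub_apply, LinearMap.mulRight_apply, LinearMap.mulLeft_apply]
        noncomm_ring
      rw [Submodule.mem_comap, e]
      exact add_mem
        (commutator_mem_gradedDerived_succ (q := s + q) (by omega) hx (ih rfl hy))
        (commutator_mem_gradedDerived_succ (p := r + q) (by omega) (ih rfl hx) hy)
    exact key hu

theorem commutator_pow_mem {V P : Submodule F R} {d : ℕ}
    (hP : ∀ x ∈ V ^ d, ∀ v ∈ V, x * v - v * x ∈ P) {p q : ℕ} (h : p + q = d + 1) {x y : R}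
    (hx : x ∈ V ^ p) (hy : y ∈ V ^ q) : x * y - y * x ∈ P := by
  induction q generalizing p x y with
  | zero =>
    rw [pow_zero, Submodule.mem_one] at hy
    obtain ⟨c, rfl⟩ := hy
    rw [Algebra.commutes, sub_self]
    exact P.zero_mem
  | succ q ih =>
    have key : V ^ (q + 1) ≤ P.comap (LinearMap.mulLeft F x - LinearMap.mulRight F x) := by
      rw [pow_succ, Submodule.mul_le]
      intro z hz v hv
      have e : (LinearMap.mulLeft F x - LinearMap.mulRight F x) (z * v) =
          ((x * z) * v - v * (x * z)) + ((v * x) * z - z * (v * x)) := by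
        simp only [LinearMap.sub_apply, LinearMap.mulRight_apply, LinearMap.mulLeft_apply]
        noncomm_ring
      rw [Submodule.mem_comap, e]
      refine add_mem (hP _ (mul_mem_pow hx hz (by omega)) v hv)
        (ih (p := 1 + p) (by omega) (mul_mem_pow ?_ hx rfl) hz)
      rwa [pow_one]
    exact key hy

/-- A family of subspaces that behaves like a homogeneous ideal for the family `V ^ d`. -/
def IsGradedIdeal (V : Submodule F R) (I : ℕ → Submodule F R) : Prop :=
  ∀ d, V * I d ≤ I (d + 1) ∧ I d * V ≤ I (d + 1)

namespace IsGradedIdeal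

variable {V : Submodule F R} {I : ℕ → Submodule F R}

theorem pow_mul_le (hI : IsGradedIdeal V I) (e d : ℕ) : V ^ e * I d ≤ I (e + d) := by
  induction e with
  | zero => simp
  | succ e ih =>
    rw [pow_succ', mul_assoc, Nat.succ_add]
    exact (mul_le_mul' le_rfl ih).trans (hI _).1

theorem mul_pow_le (hI : IsGradedIdeal V I) (d e : ℕ) : I d * V ^ e ≤ I (d + e) := by
  induction e with
  | zero => simp
  | succ e ih =>
    rw [pow_succ, ← mul_assoc]
    exact (mul_le_mul' ih le_rfl).trans (hI _).2

theorem mul_mem_left (hI : IsGradedIdeal V I) {e d n : ℕ} {a x : R} (ha : a ∈ V ^ e)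
    (hx : x ∈ I d) (h : e + d = n) : a * x ∈ I n := by
  subst h
  exact hI.pow_mul_le e d (Submodule.mul_mem_mul ha hx)

theorem mul_mem_right (hI : IsGradedIdeal V I) {e d n : ℕ} {a x : R} (hx : x ∈ I d)
    (ha : a ∈ V ^ e) (h : d + e = n) : x * a ∈ I n := by
  subst h
  exact hI.mul_pow_le d e (Submodule.mul_mem_mul hx ha)

theorem pow_le_of_le (hI : IsGradedIdeal V I) {M n : ℕ} (h : V ^ M ≤ I M) (hn : M ≤ n) :
    V ^ n ≤ I n := by
  obtain ⟨k, rfl⟩ := Nat.exists_eq_add_of_le hn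
  rw [pow_add]
  exact (mul_le_mul' h le_rfl).trans (hI.mul_pow_le M k)

theorem iSup {ι : Sort*} {I : ι → ℕ → Submodule F R} (hI : ∀ j, IsGradedIdeal V (I j)) :
    IsGradedIdeal V (⨆ j, I j) := by
  intro d
  simp only [iSup_apply, Submodule.mul_iSup, Submodule.iSup_mul]
  exact ⟨iSup_mono fun j => (hI j d).1, iSup_mono fun j => (hI j d).2⟩

theorem sup {I J : ℕ → Submodule F R} (hI : IsGradedIdeal V I) (hJ : IsGradedIdeal V J) :
    IsGradedIdeal V (I ⊔ J) := by
  intro d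
  simp only [Pi.sup_apply, Submodule.mul_sup, Submodule.sup_mul]
  exact ⟨sup_le_sup (hI d).1 (hJ d).1, sup_le_sup (hI d).2 (hJ d).2⟩

end IsGradedIdeal

/-- The graded ideal generated by an element `x` placed in degree `p`. -/
def principalGradedIdeal (V : Submodule F R) (p : ℕ) (x : R) (n : ℕ) : Submodule F R :=
  ⨆ t : ℕ × ℕ, ⨆ _ : t.1 + p + t.2 = n, V ^ t.1 * (F ∙ x) * V ^ t.2

theorem principalGradedIdeal_le {V : Submodule F R} {p : ℕ} {x : R} {n : ℕ} {P : Submodule F R}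
    (h : ∀ e f, e + p + f = n → ∀ a ∈ V ^ e, ∀ b ∈ V ^ f, a * x * b ∈ P) :
    principalGradedIdeal V p x n ≤ P := by
  refine iSup₂_le fun t ht => Submodule.mul_le.2 fun y hy b hb => ?_
  have key : V ^ t.1 * (F ∙ x) ≤ P.comap (LinearMap.mulRight F b) := by
    refine Submodule.mul_le.2 fun a ha z hz => ?_
    obtain ⟨c, rfl⟩ := Submodule.mem_span_singleton.1 hz
    simpa using P.smul_mem c (h _ _ ht a ha b hb)
  exact key hy

theorem mem_principalGradedIdeal (V : Submodule F R) (p : ℕ) (x : R) :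
    x ∈ principalGradedIdeal V p x p := by
  refine (le_iSup₂_of_le (f := fun (t : ℕ × ℕ) (_ : t.1 + p + t.2 = p) =>
    V ^ t.1 * (F ∙ x) * V ^ t.2) (0, 0) (by simp) le_rfl) ?_
  simp

theorem isGradedIdeal_principalGradedIdeal (V : Submodule F R) (p : ℕ) (x : R) :
    IsGradedIdeal V (principalGradedIdeal V p x) := by
  intro d
  simp only [principalGradedIdeal, Submodule.mul_iSup, Submodule.iSup_mul]
  constructor
  · refine iSup₂_le fun t ht => le_iSup₂_of_le (t.1 + 1, t.2) (by simp only; omega) ?_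
    simp only [pow_succ', mul_assoc, le_refl]
  · refine iSup₂_le fun t ht => le_iSup₂_of_le (t.1, t.2 + 1) (by simp only; omega) ?_
    simp only [pow_succ, mul_assoc, le_refl]

/-- Graded ideals that contain no power of `V`. -/
def IsNonNilpotentIdeal (V : Submodule F R) (I : ℕ → Submodule F R) : Prop :=
  IsGradedIdeal V I ∧ ∀ M, ¬ V ^ M ≤ I M

theorem exists_le_maximal_isNonNilpotentIdeal {V : Submodule F R} (hV : V.FG)
    {H : ℕ → Submodule F R} (hH : IsNonNilpotentIdeal V H) :
    ∃ I, H ≤ I ∧ Maximal (IsNonNilpotentIdeal V) I := by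
  refine zorn_le_nonempty₀ {I | IsNonNilpotentIdeal V I} (fun c hc hchain y hy => ?_) H hH
  refine ⟨sSup c, ⟨?_, fun M hM => ?_⟩, fun z hz => le_sSup hz⟩
  · rw [sSup_eq_iSup']
    exact IsGradedIdeal.iSup fun j => (hc j.2).1
  · have : Nonempty c := ⟨⟨y, hy⟩⟩
    have hdir : Directed (· ≤ ·) fun j : c => j.1 M := by
      intro i j
      rcases hchain.total i.2 j.2 with h | h
      · exact ⟨j, h M, le_rfl⟩
      · exact ⟨i, le_rfl, h M⟩
    rw [sSup_apply] at hM
    obtain ⟨_, ⟨j, rfl⟩, hj⟩ := (Submodule.fg_iff_compact _).1 (hV.pow M) _ _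
      (Set.range_nonempty _) hdir.directedOn_range isLUB_iSup hM
    exact (hc j.2).2 M hj

theorem mem_or_mem_of_maximal {V : Submodule F R} {I : ℕ → Submodule F R}
    (hI : Maximal (IsNonNilpotentIdeal V) I) {p q : ℕ} {x y : R}
    (hy : y ∈ V ^ q) (h : ∀ e, ∀ a ∈ V ^ e, x * a * y ∈ I (p + e + q)) : x ∈ I p ∨ y ∈ I q := by
  have big : ∀ (p : ℕ) (x : R), x ∉ I p → ∃ m, V ^ m ≤ I m ⊔ principalGradedIdeal V p x m := by
    intro p x hx
    by_contra! hcon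
    have hle := hI.2 (y := I ⊔ principalGradedIdeal V p x)
      ⟨hI.1.1.sup (isGradedIdeal_principalGradedIdeal V p x), hcon⟩ le_sup_left
    exact hx (hle p (Submodule.mem_sup_right (mem_principalGradedIdeal V p x)))
  by_contra! hxy
  obtain ⟨m, hm⟩ := big p x hxy.1
  obtain ⟨n, hn⟩ := big q y hxy.2
  have hG := hI.1.1
  have step : ∀ e, ∀ a ∈ V ^ m, ∀ b ∈ V ^ e, a * (b * y) ∈ I (m + e + q) := by
    intro e a ha b hb
    have key : V ^ m ≤ (I (m + e + q)).comap (LinearMap.mulRight F (b * y)) := by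
      refine hm.trans (sup_le (fun z hz => hG.mul_mem_right hz (mul_mem_pow hb hy rfl)
        (by omega)) ?_)
      refine principalGradedIdeal_le fun e₁ e₂ he a₁ ha₁ a₂ ha₂ => ?_
      have := hG.mul_mem_left ha₁ (h _ _ (mul_mem_pow ha₂ hb rfl)) (n := m + e + q) (by omega)
      simpa [mul_assoc] using this
    exact key ha
  refine hI.1.2 (m + n) ?_
  rw [pow_add, Submodule.mul_le]
  intro a ha b hb
  have key : V ^ n ≤ (I (m + n)).comap (LinearMap.mulLeft F a) := by
    refine hn.trans (sup_le (fun z hz => hG.mul_mem_left ha hz rfl) ?_)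
    refine principalGradedIdeal_le fun e f hef b₁ hb₁ b₂ hb₂ => ?_
    have := hG.mul_mem_right (step e a ha b₁ hb₁) hb₂ (n := m + n) (by omega)
    simpa [mul_assoc] using this
  exact key hb

theorem mem_of_forall_mul_mul_mem {V : Submodule F R} {I : ℕ → Submodule F R}
    (hI : Maximal (IsNonNilpotentIdeal V) I) {p : ℕ} {x : R} (hx : x ∈ V ^ p)
    (h : ∀ e, ∀ a ∈ V ^ e, x * a * x ∈ I (p + e + p)) : x ∈ I p :=
  (mem_or_mem_of_maximal hI hx h).elim id id

/-- The elements of the family `D` commute with all elements of all `V ^ q` modulo `I`. -/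
def IsCentralModulo (V : Submodule F R) (I D : ℕ → Submodule F R) : Prop :=
  ∀ p q, ∀ u ∈ D p, ∀ b ∈ V ^ q, u * b - b * u ∈ I (p + q)

theorem isCentralModulo_of_succ (h2 : (2 : F) ≠ 0) {V : Submodule F R} {I : ℕ → Submodule F R}
    (hI : Maximal (IsNonNilpotentIdeal V) I) {j : ℕ}
    (hj : IsCentralModulo V I (gradedDerived V (j + 1))) :
    IsCentralModulo V I (gradedDerived V j) := by
  have hG := hI.1.1
  intro p q v hv a ha
  have hvp := gradedDerived_le_pow V j p hv
  have ad_mem : ∀ {q n : ℕ} {a : R}, a ∈ V ^ q → p + q = n →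
      v * a - a * v ∈ gradedDerived V j n :=
    fun ha h => commutator_mem_gradedDerived h hv ha
  have ad_mem_pow : ∀ {q n : ℕ} {a : R}, a ∈ V ^ q → p + q = n → v * a - a * v ∈ V ^ n :=
    fun ha h => gradedDerived_le_pow V j _ (ad_mem ha h)
  have ad2_mem : ∀ {q n : ℕ} {a : R}, a ∈ V ^ q → p + (p + q) = n →
      v * (v * a - a * v) - (v * a - a * v) * v ∈ gradedDerived V (j + 1) n :=
    fun ha h => commutator_mem_gradedDerived_succ h hv (ad_mem ha rfl)
  have ad2_central : ∀ {q r n : ℕ} {a b : R}, a ∈ V ^ q → b ∈ V ^ r → p + (p + q) + r = n →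
      (v * (v * a - a * v) - (v * a - a * v) * v) * b -
        b * (v * (v * a - a * v) - (v * a - a * v) * v) ∈ I n := by
    intro q r n a b ha hb h
    subst h
    exact hj _ _ _ (ad2_mem ha rfl) b hb
  have ad2_zero : ∀ {q n : ℕ} {a : R}, a ∈ V ^ q → p + (p + q) = n →
      v * (v * a - a * v) - (v * a - a * v) * v ∈ I n := by
    intro q n a ha h
    subst h
    have hzp := gradedDerived_le_pow V _ _ (ad2_mem ha rfl)
    refine mem_of_forall_mul_mul_mem hI hzp fun e b hb => ?_
    have h1 := ad2_central (n := p + (p + (q + p)) + (p + q)) (mul_mem_pow ha hvp rfl)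
      (ad_mem_pow ha rfl) rfl
    have h2 := hG.mul_mem_right (n := p + (p + (q + p)) + (p + q))
      (ad2_central ha (ad_mem_pow ha rfl) rfl) hvp (by omega)
    have h3 := hG.mul_mem_left (n := p + (p + q) + e + (p + (p + q))) hzp
      (ad2_central ha hb rfl) (by omega)
    have h4 := hG.mul_mem_right (n := p + (p + q) + e + (p + (p + q))) (sub_mem h1 h2) hb
      (by omega)
    set w := v * a - a * v with hw
    set z := v * w - w * v with hz
    have e1 : v * (v * (a * v) - a * v * v) - (v * (a * v) - a * v * v) * v = z * v := by
      rw [hz, hw]; noncomm_ring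
    rw [e1] at h4
    have e2 : z * b * z = (z * v * w - w * (z * v) - (z * w - w * z) * v) * b
        - z * (z * b - b * z) := by
      rw [hz]; noncomm_ring
    rw [e2]
    exact sub_mem h4 h3
  have two_mem : ∀ {n : ℕ} {x : R}, (2 : F) • x ∈ I n → x ∈ I n := by
    intro n x hx
    have := (I n).smul_mem (2 : F)⁻¹ hx
    rwa [smul_smul, inv_mul_cancel₀ h2, one_smul] at this
  have ad_mul_ad_mem : ∀ {r s n : ℕ} {b c : R}, b ∈ V ^ r → c ∈ V ^ s → p + r + (p + s) = n →
      (v * b - b * v) * (v * c - c * v) ∈ I n := by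
    intro r s n b c hb hc h
    apply two_mem
    have h1 := ad2_zero (n := n) (mul_mem_pow hb hc rfl) (by omega)
    have h2 := hG.mul_mem_right (n := n) (ad2_zero hb rfl) hc (by omega)
    have h3 := hG.mul_mem_left (n := n) hb (ad2_zero hc rfl) (by omega)
    convert sub_mem (sub_mem h1 h2) h3 using 1
    rw [two_smul]
    noncomm_ring
  refine mem_of_forall_mul_mul_mem hI (ad_mem_pow ha rfl) fun e c hc => ?_
  have h1 := ad_mul_ad_mem (n := p + q + e + (p + q)) ha (mul_mem_pow hc ha rfl) (by omega)
  have h2 := hG.mul_mem_right (n := p + q + e + (p + q)) (ad_mul_ad_mem ha hc rfl) ha (by omega)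
  convert sub_mem h1 h2 using 1
  noncomm_ring

/-- A Lie solvable quotient of an algebra generated by nilpotent elements is nilpotent. -/
theorem exists_pow_le_of_gradedDerived_le (h2 : (2 : F) ≠ 0) {S : Set R} (hS : S.Finite)
    (hnil : ∀ s ∈ S, IsNilpotent s) {H : ℕ → Submodule F R}
    (hH : IsGradedIdeal (Submodule.span F S) H) {k : ℕ}
    (hk : ∀ d, gradedDerived (Submodule.span F S) k d ≤ H d) :
    ∃ M, Submodule.span F S ^ M ≤ H M := by
  set V := Submodule.span F S with hV
  by_contra! hcon
  obtain ⟨I, hHI, hI⟩ :=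
    exists_le_maximal_isNonNilpotentIdeal (Submodule.fg_span hS) ⟨hH, hcon⟩
  have hG := hI.1.1
  have hcentral : ∀ j, IsCentralModulo V I (gradedDerived V j) → IsCentralModulo V I
      (gradedDerived V 0) := by
    intro j
    induction j with
    | zero => exact id
    | succ j ih => exact fun h => ih (isCentralModulo_of_succ h2 hI h)
  have hc := hcentral k fun p q u hu b hb =>
    sub_mem (hG.mul_mem_right (hHI p (hk p hu)) hb rfl)
      (hG.mul_mem_left hb (hHI p (hk p hu)) (by omega))
  refine hI.1.2 1 ?_
  rw [pow_one, Submodule.span_le]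
  intro s hs
  have hs1 : s ∈ V ^ 1 := by rw [pow_one]; exact Submodule.subset_span hs
  have descent : ∀ n, s ^ n ∈ I n → s ∈ I 1 := by
    intro n
    induction n with
    | zero =>
      intro h
      simpa using hG.mul_mem_left hs1 h rfl
    | succ n ih =>
      intro h
      have hsn : s ^ n ∈ V ^ n := Submodule.pow_mem_pow V (by simpa using hs1) n
      refine (mem_or_mem_of_maximal hI hs1 fun e a ha => ?_).elim ih id
      have h3 := hG.mul_mem_right (n := n + e + 1) h ha (by omega)
      have h4 := hG.mul_mem_left (n := n + e + 1) hsn (hc 1 e s hs1 a ha) (by omega)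
      convert sub_mem h3 h4 using 1
      rw [pow_succ]
      noncomm_ring
  obtain ⟨n, hn⟩ := hnil s hs
  exact descent n (by rw [hn]; exact zero_mem _)

/-- The largest graded ideal consisting of elements `w` with `[w, V ^ q] ⊆ U`. -/
def lieTransporter (V : Submodule F R) (U : ℕ → Submodule F R) (n : ℕ) : Submodule F R where
  carrier := {x | ∀ e f q, ∀ a ∈ V ^ e, ∀ b ∈ V ^ f, ∀ c ∈ V ^ q,
    a * x * b * c - c * (a * x * b) ∈ U (e + n + f + q)}
  zero_mem' := by
    intro e f q a _ b _ c _
    simp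
  add_mem' := by
    intro x y hx hy e f q a ha b hb c hc
    convert add_mem (hx e f q a ha b hb c hc) (hy e f q a ha b hb c hc) using 1
    noncomm_ring
  smul_mem' := by
    intro r x hx e f q a ha b hb c hc
    convert (U _).smul_mem r (hx e f q a ha b hb c hc) using 1
    simp [smul_sub]

theorem isGradedIdeal_lieTransporter (V : Submodule F R) (U : ℕ → Submodule F R) :
    IsGradedIdeal V (lieTransporter V U) := by
  intro d
  constructor
  · refine Submodule.mul_le.2 fun v hv x hx e f q a ha b hb c hc => ?_
    have := hx (e + 1) f q (a * v) (by rw [pow_succ]; exact Submodule.mul_mem_mul ha hv) b hb c hc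
    rw [show e + (d + 1) + f + q = e + 1 + d + f + q by omega]
    simpa only [mul_assoc] using this
  · refine Submodule.mul_le.2 fun x hx v hv e f q a ha b hb c hc => ?_
    have := hx e (f + 1) q a ha (v * b) (by rw [pow_succ']; exact Submodule.mul_mem_mul hv hb) c hc
    rw [show e + (d + 1) + f + q = e + d + (f + 1) + q by omega]
    simpa only [mul_assoc] using this

theorem gradedDerived_succ_le_lieTransporter (V : Submodule F R) (k d : ℕ) :
    gradedDerived V (k + 1) d ≤ lieTransporter V (gradedDerived V k) d := by
  rw [gradedDerived_succ_le]
  intro r s hrs u hu v hv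
  have hup := gradedDerived_le_pow V k r hu
  have hvp := gradedDerived_le_pow V k s hv
  -- `[[u, v] * b, c]` decomposes as a sum of brackets with elements of the Lie ideal
  have right : ∀ {f q n : ℕ} {b c : R}, b ∈ V ^ f → c ∈ V ^ q → r + s + f + q = n →
      (u * v - v * u) * b * c - c * ((u * v - v * u) * b) ∈ gradedDerived V k n := by
    intro f q n b c hb hc h
    have h1 : u * (v * b) - (v * b) * u ∈ gradedDerived V k (r + (s + f)) :=
      commutator_mem_gradedDerived rfl hu (mul_mem_pow hvp hb rfl)
    have h2 : u * b - b * u ∈ gradedDerived V k (r + f) := commutator_mem_gradedDerived rfl hu hb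
    have h2p := gradedDerived_le_pow V k _ h2
    have t1 := commutator_mem_gradedDerived (n := n) (by omega) h1 hc
    have t2 := commutator_mem_gradedDerived (n := n) (by omega) hv (mul_mem_pow h2p hc rfl)
    have t3 := commutator_mem_gradedDerived (n := n) (by omega) h2 (mul_mem_pow hc hvp rfl)
    convert sub_mem (sub_mem t1 t2) t3 using 1
    noncomm_ring
  intro e f q a ha b hb c hc
  subst hrs
  have t1 := right (n := r + s + f + e) hb ha (by omega)
  have t2 := commutator_mem_gradedDerived (n := e + (r + s) + f + q) (by omega) t1 hc
  have t3 := right (n := e + (r + s) + f + q) (mul_mem_pow hb ha rfl) hc (by omega)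
  convert sub_mem t3 t2 using 1
  noncomm_ring

theorem exists_gradedDerived_le_succ (h2 : (2 : F) ≠ 0) {S : Set R} (hS : S.Finite)
    (hnil : ∀ s ∈ S, IsNilpotent s) {k : ℕ} (hk : 1 ≤ k) :
    ∃ M, ∀ d, M < d → gradedDerived (Submodule.span F S) k d ≤
      gradedDerived (Submodule.span F S) (k + 1) d := by
  set V := Submodule.span F S with hV
  have hT := isGradedIdeal_lieTransporter V (gradedDerived V (k + 1))
  obtain ⟨M, hM⟩ := exists_pow_le_of_gradedDerived_le h2 hS hnil hT
    (gradedDerived_succ_le_lieTransporter V (k + 1))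
  refine ⟨M, fun d hd => ?_⟩
  obtain ⟨d, rfl⟩ : ∃ m, d = m + 1 := ⟨d - 1, by omega⟩
  refine (gradedDerived_le_one V hk _).trans ?_
  rw [gradedDerived_succ_le]
  intro p q hpq u hu v hv
  refine commutator_pow_mem (V := V) (fun x hx w hw => ?_) hpq
    (gradedDerived_le_pow V 0 p hu) (gradedDerived_le_pow V 0 q hv)
  have := hT.pow_le_of_le hM (n := d) (by omega) hx 0 0 1 1 one_mem_pow_zero 1 one_mem_pow_zero w
    (by simpa using hw)
  simpa using this

end Graded

section Unitization

variable {F : Type*} [Field F] {A : Type*} [NonUnitalRing A] [Module F A]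

/-- The inclusion of `A` into its unitization, as a linear map. -/
abbrev inrLinear (F : Type*) [Field F] (A : Type*) [NonUnitalRing A] [Module F A] :
    A →ₗ[F] Unitization F A :=
  Unitization.inrHom F F A

theorem inr_commutator (a b : A) : inrLinear F A (a * b - b * a) =
    inrLinear F A a * inrLinear F A b - inrLinear F A b * inrLinear F A a := by
  simp [Unitization.inrHom]

variable [SMulCommClass F A A] [IsScalarTower F A A]

theorem inr_nuPow (a : A) (n : ℕ) :
    ((nuPow a n : A) : Unitization F A) = (a : Unitization F A) ^ (n + 1) := by
  induction n with
  | zero => simp [nuPow]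
  | succ n ih => rw [nuPow, Unitization.inr_mul, ih, ← pow_succ']

theorem pow_succ_le_range_inr {V : Submodule F (Unitization F A)}
    (hV : V ≤ LinearMap.range (inrLinear F A)) (d : ℕ) :
    V ^ (d + 1) ≤ LinearMap.range (inrLinear F A) := by
  induction d with
  | zero => simpa using hV
  | succ d ih =>
    rw [pow_succ, Submodule.mul_le]
    intro x hx y hy
    obtain ⟨a, rfl⟩ := ih hx
    obtain ⟨b, rfl⟩ := hV hy
    exact ⟨a * b, Unitization.inr_mul F a b⟩

theorem map_derivedPower_eq_iSup {S : Set A} (hgen : algClosure F S = ⊤) (i : ℕ) :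
    (derivedPower F A i).map (inrLinear F A) =
      ⨆ d, gradedDerived (Submodule.span F (inrLinear F A '' S)) i d := by
  set V := Submodule.span F (inrLinear F A '' S) with hV
  have hVr : V ≤ LinearMap.range (inrLinear F A) := by
    rw [hV, Submodule.span_le]
    rintro _ ⟨a, -, rfl⟩
    exact ⟨a, rfl⟩
  induction i with
  | zero =>
    apply le_antisymm
    · rw [Submodule.map_le_iff_le_comap, derivedPower, ← hgen]
      refine sInf_le ⟨fun a ha => ?_, fun x hx y hy => ?_⟩
      · refine Submodule.mem_iSup_of_mem 1 ?_
        change _ ∈ V ^ 1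
        rw [pow_one]
        exact Submodule.subset_span ⟨a, ha, rfl⟩
      · have hmul : (⨆ d, gradedDerived V 0 d) * (⨆ d, gradedDerived V 0 d) ≤
            ⨆ d, gradedDerived V 0 d := by
          rw [Submodule.iSup_mul]
          refine iSup_le fun p => ?_
          rw [Submodule.mul_iSup]
          refine iSup_le fun q => le_iSup_of_le (p + q) ?_
          rcases p with _ | p
          · rw [gradedDerived_degree_zero, Submodule.bot_mul]; exact bot_le
          · change V ^ (p + 1) * _ ≤ _
            have e : p + 1 + q = p + q + 1 := by omega
            rw [e]
            change _ ≤ V ^ (p + q + 1)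
            rw [← e]
            exact (mul_le_mul' le_rfl (gradedDerived_le_pow V 0 q)).trans (pow_add V _ q).ge
        have := hmul (Submodule.mul_mem_mul hx hy)
        rw [Submodule.mem_comap]
        convert this using 1
        exact Unitization.inr_mul F x y
    · refine iSup_le fun d => ?_
      rw [derivedPower, Submodule.map_top]
      rcases d with _ | d
      · rw [gradedDerived_degree_zero]; exact bot_le
      · exact pow_succ_le_range_inr hVr d
  | succ i ih =>
    apply le_antisymm
    · rw [Submodule.map_le_iff_le_comap, derivedPower, commSpan_le]
      intro x hx y hy
      rw [Submodule.mem_comap, inr_commutator]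
      have hx' : inrLinear F A x ∈ ⨆ d, gradedDerived V i d := ih ▸ Submodule.mem_map_of_mem hx
      have hy' : inrLinear F A y ∈ ⨆ d, gradedDerived V i d := ih ▸ Submodule.mem_map_of_mem hy
      generalize inrLinear F A x = u at hx'
      generalize inrLinear F A y = w at hy'
      induction hx' using Submodule.iSup_induction' with
      | zero => simp
      | add a b _ _ ha hb =>
        convert add_mem ha hb using 1
        noncomm_ring
      | mem p u hu =>
        induction hy' using Submodule.iSup_induction' with
        | zero => simp
        | add a b _ _ ha hb =>
          convert add_mem ha hb using 1
          noncomm_ring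
        | mem q w hw =>
          exact Submodule.mem_iSup_of_mem (p + q) (commutator_mem_gradedDerived_succ rfl hu hw)
    · refine iSup_le fun d => ?_
      rw [gradedDerived_succ_le]
      intro p q _ u hu w hw
      have hu' : u ∈ (derivedPower F A i).map (inrLinear F A) :=
        ih ▸ Submodule.mem_iSup_of_mem p hu
      have hw' : w ∈ (derivedPower F A i).map (inrLinear F A) :=
        ih ▸ Submodule.mem_iSup_of_mem q hw
      obtain ⟨x, hx, rfl⟩ := hu'
      obtain ⟨y, hy, rfl⟩ := hw'
      rw [← inr_commutator]
      exact Submodule.mem_map_of_mem (commutator_mem_commSpan hx hy)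

end Unitization

/-- Let `A` be an associative algebra over a field of characteristic `≠ 2`
generated by a finite collection of nilpotent elements.  Then every Lie derived power
`A^{[i]}`, `i ≥ 1`, is a finitely generated Lie algebra. -/
theorem derivedPower_finitelyGenerated_of_nilpotent_generators
    (F : Type*) [Field F] (hchar : ringChar F ≠ 2)
    (A : Type*) [NonUnitalRing A] [Module F A] [SMulCommClass F A A] [IsScalarTower F A A]
    (S : Finset A) (hnil : ∀ a ∈ S, ∃ n : ℕ, nuPow a n = 0)
    (hgen : algClosure F (↑S : Set A) = ⊤)
    (i : ℕ) (hi : 1 ≤ i) :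
    ∃ T : Finset A, (↑T : Set A) ⊆ (derivedPower F A i : Set A) ∧
      lieClosure F (↑T : Set A) = derivedPower F A i := by
  have h2 : (2 : F) ≠ 0 := Ring.two_ne_zero hchar
  have hinj : Function.Injective (inrLinear F A) := Unitization.inr_injective
  set S' : Set (Unitization F A) := inrLinear F A '' (S : Set A) with hS'
  have hfin : S'.Finite := S.finite_toSet.image _
  have hnil' : ∀ s ∈ S', IsNilpotent s := by
    rintro _ ⟨a, ha, rfl⟩
    obtain ⟨n, hn⟩ := hnil a ha
    refine ⟨n + 1, ?_⟩
    exact (inr_nuPow (F := F) a n).symm.trans (by rw [hn, Unitization.inr_zero])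
  set V := Submodule.span F S' with hV
  have hVfg : V.FG := Submodule.fg_span hfin
  have hmap := map_derivedPower_eq_iSup hgen i
  obtain ⟨M, hM⟩ := exists_gradedDerived_le_succ h2 hfin hnil' hi
  have hle : ∀ d, gradedDerived V i d ≤ (derivedPower F A i).map (inrLinear F A) :=
    fun d => hmap ▸ le_iSup (gradedDerived V i) d
  set Q := ⨆ d ∈ Finset.range (M + 1), gradedDerived V i d with hQ
  have hQfg : Q.FG := Submodule.fg_biSup _ _ fun d _ =>
    (hVfg.pow d).of_le (gradedDerived_le_pow V i d)
  have hQle : Q ≤ (derivedPower F A i).map (inrLinear F A) := iSup₂_le fun d _ => hle d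
  have hQmap : (Q.comap (inrLinear F A)).map (inrLinear F A) = Q :=
    Submodule.map_comap_eq_of_le (hQle.trans LinearMap.map_le_range)
  obtain ⟨T, hT⟩ : (Q.comap (inrLinear F A)).FG :=
    Submodule.fg_of_fg_map_injective _ hinj (hQmap.symm ▸ hQfg)
  have hTD : (T : Set A) ⊆ derivedPower F A i := by
    intro t ht
    have : t ∈ Q.comap (inrLinear F A) := hT ▸ Submodule.subset_span ht
    obtain ⟨t', ht', h⟩ := hQle this
    exact hinj h ▸ ht'
  refine ⟨T, hTD, le_antisymm (lieClosure_le_derivedPower hTD) ?_⟩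
  have hgenerated : ∀ d, gradedDerived V i d ≤
      (lieClosure F (T : Set A)).map (inrLinear F A) := by
    intro d
    induction d using Nat.strong_induction_on with
    | _ d ih =>
      by_cases hd : d ≤ M
      · have h1 : gradedDerived V i d ≤ Q :=
          le_iSup₂_of_le (f := fun d (_ : d ∈ Finset.range (M + 1)) => gradedDerived V i d) d
            (Finset.mem_range.2 (by omega)) le_rfl
        rw [← hQmap, ← hT] at h1
        exact h1.trans (Submodule.map_mono (Submodule.span_le.2 (subset_lieClosure _)))
      · refine (hM d (by omega)).trans ?_
        rw [gradedDerived_succ_le]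
        intro p q hpq u hu w hw
        rcases Nat.eq_zero_or_pos p with rfl | hp
        · rw [gradedDerived_degree_zero, Submodule.mem_bot] at hu
          simp [hu]
        rcases Nat.eq_zero_or_pos q with rfl | hq
        · rw [gradedDerived_degree_zero, Submodule.mem_bot] at hw
          simp [hw]
        obtain ⟨x, hx, rfl⟩ := ih p (by omega) hu
        obtain ⟨y, hy, rfl⟩ := ih q (by omega) hw
        rw [← inr_commutator]
        exact Submodule.mem_map_of_mem (commutator_mem_lieClosure hx hy)
  rw [← Submodule.map_le_map_iff_of_injective hinj, hmap]
  exact iSup_le hgenerated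
end

section
/- Let A be a finitely graded associative algebra over a field of characteristic ≠ 2, i.e., A = A_1 ⊕ A_2 ⊕ ⋯ with A_i A_j ⊆ A_{i+j}, A is generated as an associative algebra by A_1, and dim_F A_1 < ∞. Suppose that for every i ≥ 1 the quotient algebra A / id_A(A^{[i]}) is nilpotent. Then for every i ≥ 1 the Lie derived power A^{[i]} is a finitely generated Lie algebra. -/
/-- The linear span of all products `u * v` with `u ∈ U`, `v ∈ V`. -/
def mulSpan (F : Type*) [Field F] {A : Type*} [NonUnitalRing A] [Module F A]
    [SMulCommClass F A A] [IsScalarTower F A A] (U V : Submodule F A) : Submodule F A :=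
  Submodule.span F {x | ∃ u ∈ U, ∃ v ∈ V, x = u * v}

/-- `subPow F V n` is the span `V^{n+1}` of all products of `n + 1` elements of `V`. -/
def subPow (F : Type*) [Field F] {A : Type*} [NonUnitalRing A] [Module F A]
    [SMulCommClass F A A] [IsScalarTower F A A] (V : Submodule F A) : ℕ → Submodule F A
  | 0 => V
  | n + 1 => mulSpan F V (subPow F V n)

/-- The two-sided associative ideal of `A` generated by a set `S`. -/
def algIdealGen (F : Type*) [Field F] {A : Type*} [NonUnitalRing A] [Module F A]
    [SMulCommClass F A A] [IsScalarTower F A A] (S : Set A) : Submodule F A :=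
  sInf {p : Submodule F A | S ⊆ ↑p ∧ ∀ a : A, ∀ x ∈ p, a * x ∈ p ∧ x * a ∈ p}

theorem mem_of_mem_iSup_of_mem {F A : Type*} [Field F] [AddCommGroup A] [Module F A]
    {𝒜 W : ℕ → Submodule F A} (hdirect : DirectSum.IsInternal 𝒜)
    (hW : ∀ d, W d ≤ 𝒜 d) {x : A} (hx : x ∈ ⨆ d, W d) {d : ℕ} (hxd : x ∈ 𝒜 d) : x ∈ W d := by
  let := hdirect.chooseDecomposition
  rw [← DirectSum.decompose_of_mem_same 𝒜 hxd]
  refine Submodule.iSup_induction W (motive := fun x => (DirectSum.decompose 𝒜 x d : A) ∈ W d)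
    hx ?_ ?_ ?_
  · intro e y hy
    by_cases h : e = d
    · subst h
      rwa [DirectSum.decompose_of_mem_same 𝒜 (hW e hy)]
    · rw [DirectSum.decompose_of_mem_ne 𝒜 (hW e hy) h]
      exact zero_mem _
  · simp
  · intro y z hy hz
    rw [DirectSum.decompose_add]
    exact add_mem hy hz

section DerivedPowers

variable {F : Type*} [Field F] {A : Type*} [NonUnitalRing A] [Module F A]
  [SMulCommClass F A A] [IsScalarTower F A A]

theorem mul_mem_mulSpan {U V : Submodule F A} {u v : A} (hu : u ∈ U) (hv : v ∈ V) :
    u * v ∈ mulSpan F U V :=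
  Submodule.subset_span ⟨u, hu, v, hv, rfl⟩

theorem mulSpan_mono {U U' V V' : Submodule F A} (hU : U ≤ U') (hV : V ≤ V') :
    mulSpan F U V ≤ mulSpan F U' V' :=
  Submodule.span_mono fun _ ⟨u, hu, v, hv, h⟩ => ⟨u, hU hu, v, hV hv, h⟩

theorem mulSpan_eq_map₂ (U V : Submodule F A) :
    mulSpan F U V = Submodule.map₂ (LinearMap.mul F A) U V := by
  apply le_antisymm
  · refine Submodule.span_le.2 ?_
    rintro _ ⟨u, hu, v, hv, rfl⟩
    exact Submodule.apply_mem_map₂ (LinearMap.mul F A) hu hv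
  · exact Submodule.map₂_le.2 fun u hu v hv => mul_mem_mulSpan hu hv

theorem subPow_mono {V W : Submodule F A} (h : V ≤ W) (n : ℕ) :
    subPow F V n ≤ subPow F W n := by
  induction n with
  | zero => exact h
  | succ n ih => exact mulSpan_mono h ih

theorem subPow_top_antitone : Antitone (subPow F (⊤ : Submodule F A)) := by
  refine antitone_nat_of_succ_le fun n => ?_
  induction n with
  | zero => exact le_top
  | succ n ih => exact mulSpan_mono le_rfl ih

theorem mul_mem_subPow {V : Submodule F A} {m n : ℕ} {x y : A} (hx : x ∈ subPow F V m)
    (hy : y ∈ subPow F V n) : x * y ∈ subPow F V (m + n + 1) := by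
  induction m generalizing x with
  | zero => rw [zero_add]; exact mul_mem_mulSpan hx hy
  | succ m ih =>
    refine Submodule.span_induction (p := fun x _ => x * y ∈ subPow F V (m + 1 + n + 1))
      ?_ ?_ ?_ ?_ hx
    · rintro _ ⟨u, hu, v, hv, rfl⟩
      rw [mul_assoc, show m + 1 + n + 1 = (m + n + 1) + 1 by ring]
      exact mul_mem_mulSpan hu (ih hv)
    · simp
    · intro a b _ _ ha hb
      rw [add_mul]
      exact add_mem ha hb
    · intro c a _ ha
      rw [smul_mul_assoc]
      exact Submodule.smul_mem _ c ha

theorem subPow_fg {V : Submodule F A} (hV : V.FG) (n : ℕ) : (subPow F V n).FG := by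
  induction n with
  | zero => exact hV
  | succ n ih =>
    change (mulSpan F V (subPow F V n)).FG
    rw [mulSpan_eq_map₂]
    exact hV.map₂ _ ih

theorem derivedPower_commutator_mem (i : ℕ) {u : A} (hu : u ∈ derivedPower F A i) (a : A) :
    u * a - a * u ∈ derivedPower F A i := by
  induction i generalizing u with
  | zero => exact Submodule.mem_top
  | succ i ih =>
    refine Submodule.span_induction
      (p := fun u _ => u * a - a * u ∈ derivedPower F A (i + 1)) ?_ ?_ ?_ ?_ hu
    · rintro _ ⟨x, hx, y, hy, rfl⟩
      have h : (x * y - y * x) * a - a * (x * y - y * x) =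
          ((x * a - a * x) * y - y * (x * a - a * x)) +
            (x * (y * a - a * y) - (y * a - a * y) * x) := by noncomm_ring
      rw [h]
      exact add_mem (commutator_mem_commSpan (ih hx) hy) (commutator_mem_commSpan hx (ih hy))
    · simp
    · intro x y _ _ hx hy
      rw [show (x + y) * a - a * (x + y) = (x * a - a * x) + (y * a - a * y) by noncomm_ring]
      exact add_mem hx hy
    · intro c x _ hx
      rw [smul_mul_assoc, mul_smul_comm, ← smul_sub]
      exact Submodule.smul_mem _ c hx

theorem derivedPower_antitone : Antitone (derivedPower F A) := by
  refine antitone_nat_of_succ_le fun i => Submodule.span_le.2 ?_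
  rintro _ ⟨u, hu, v, _, rfl⟩
  exact derivedPower_commutator_mem i hu v

/-- The elements all of whose commutators lie in `U`. -/
def commTransporter (U : Submodule F A) : Submodule F A where
  carrier := {x | ∀ a, x * a - a * x ∈ U}
  zero_mem' a := by simp
  add_mem' {x y} hx hy a := by
    rw [show (x + y) * a - a * (x + y) = (x * a - a * x) + (y * a - a * y) by noncomm_ring]
    exact add_mem (hx a) (hy a)
  smul_mem' c x hx a := by
    rw [smul_mul_assoc, mul_smul_comm, ← smul_sub]
    exact U.smul_mem c (hx a)

theorem mul_mem_commTransporter {U : Submodule F A} {x y : A} (hx : x ∈ commTransporter U)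
    (hy : y ∈ commTransporter U) : x * y ∈ commTransporter U := fun a => by
  rw [show x * y * a - a * (x * y) =
    (x * (y * a) - (y * a) * x) + (y * (a * x) - (a * x) * y) by noncomm_ring]
  exact add_mem (hx _) (hy _)

/-- The largest two-sided ideal contained in `T`. -/
def idealCore (T : Submodule F A) : Submodule F A where
  carrier := {x | x ∈ T ∧ (∀ r, x * r ∈ T) ∧ (∀ s, s * x ∈ T) ∧ ∀ r s, s * (x * r) ∈ T}
  zero_mem' := by simp
  add_mem' {x y} hx hy := by
    refine ⟨add_mem hx.1 hy.1, fun r => ?_, fun s => ?_, fun r s => ?_⟩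
    · rw [add_mul]; exact add_mem (hx.2.1 r) (hy.2.1 r)
    · rw [mul_add]; exact add_mem (hx.2.2.1 s) (hy.2.2.1 s)
    · rw [add_mul, mul_add]; exact add_mem (hx.2.2.2 r s) (hy.2.2.2 r s)
  smul_mem' c x hx := by
    refine ⟨T.smul_mem c hx.1, fun r => ?_, fun s => ?_, fun r s => ?_⟩
    · rw [smul_mul_assoc]; exact T.smul_mem c (hx.2.1 r)
    · rw [mul_smul_comm]; exact T.smul_mem c (hx.2.2.1 s)
    · rw [smul_mul_assoc, mul_smul_comm]; exact T.smul_mem c (hx.2.2.2 r s)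

theorem idealCore_le (T : Submodule F A) : idealCore T ≤ T := fun _ hx => hx.1

theorem mul_mem_idealCore {T : Submodule F A} (a : A) {x : A} (hx : x ∈ idealCore T) :
    a * x ∈ idealCore T ∧ x * a ∈ idealCore T := by
  refine ⟨⟨hx.2.2.1 a, fun r => ?_, fun s => ?_, fun r s => ?_⟩,
    ⟨hx.2.1 a, fun r => ?_, fun s => hx.2.2.2 a s, fun r s => ?_⟩⟩
  · rw [mul_assoc]; exact hx.2.2.2 r a
  · rw [← mul_assoc]; exact hx.2.2.1 _
  · rw [mul_assoc, ← mul_assoc]; exact hx.2.2.2 _ _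
  · rw [mul_assoc]; exact hx.2.1 _
  · rw [mul_assoc]; exact hx.2.2.2 _ _

/-- Herstein: for a Lie ideal `U`, the ideal generated by `[U, U]` satisfies `[I, A] ⊆ U`. -/
theorem algIdealGen_commSpan_le_commTransporter {U : Submodule F A}
    (hU : ∀ u ∈ U, ∀ a, u * a - a * u ∈ U) :
    algIdealGen F (commSpan F U U : Set A) ≤ commTransporter U := by
  have hUT : U ≤ commTransporter U := hU
  have hle : commSpan F U U ≤ idealCore (commTransporter U) := by
    refine Submodule.span_le.2 ?_
    rintro _ ⟨u, hu, v, hv, rfl⟩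
    have huv : u * v - v * u ∈ U := hU u hu v
    have hright (r : A) : (u * v - v * u) * r ∈ commTransporter U := by
      rw [show (u * v - v * u) * r = (u * (v * r) - v * r * u) - v * (u * r - r * u) by
        noncomm_ring]
      exact sub_mem (hUT (hU u hu _)) (mul_mem_commTransporter (hUT hv) (hUT (hU u hu r)))
    refine ⟨hUT huv, hright, fun s => ?_, fun r s => ?_⟩
    · have := sub_mem (hright s) (hUT (hU _ huv s))
      rwa [sub_sub_cancel] at this
    · have := sub_mem (hright (r * s)) (hUT (hright r s))
      rwa [← mul_assoc, sub_sub_cancel] at this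
  have hgen : algIdealGen F (commSpan F U U : Set A) ≤ idealCore (commTransporter U) :=
    sInf_le ⟨hle, fun a x hx => mul_mem_idealCore a hx⟩
  exact hgen.trans (idealCore_le _)

/-- The span of the commutators of homogeneous elements of `U` of total degree `d`. -/
def homogeneousCommSpan (𝒜 : ℕ → Submodule F A) (U : Submodule F A) (d : ℕ) : Submodule F A :=
  Submodule.span F {x | ∃ p q, p + q = d ∧ ∃ u ∈ U ⊓ 𝒜 p, ∃ v ∈ U ⊓ 𝒜 q, x = u * v - v * u}

theorem homogeneousCommSpan_le {𝒜 : ℕ → Submodule F A}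
    (hmul : ∀ p q : ℕ, ∀ x ∈ 𝒜 p, ∀ y ∈ 𝒜 q, x * y ∈ 𝒜 (p + q)) (U : Submodule F A) (d : ℕ) :
    homogeneousCommSpan 𝒜 U d ≤ commSpan F U U ⊓ 𝒜 d := by
  refine Submodule.span_le.2 ?_
  rintro _ ⟨p, q, rfl, u, hu, v, hv, rfl⟩
  refine ⟨commutator_mem_commSpan hu.1 hv.1, sub_mem (hmul p q u hu.2 v hv.2) ?_⟩
  rw [add_comm]
  exact hmul q p v hv.2 u hu.2

theorem commSpan_le_iSup_homogeneousCommSpan {𝒜 : ℕ → Submodule F A} {U : Submodule F A}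
    (hU : U ≤ ⨆ d, U ⊓ 𝒜 d) : commSpan F U U ≤ ⨆ d, homogeneousCommSpan 𝒜 U d := by
  refine Submodule.span_le.2 ?_
  rintro _ ⟨u, hu, v, hv, rfl⟩
  refine Submodule.iSup_induction (fun d => U ⊓ 𝒜 d)
    (motive := fun u => u * v - v * u ∈ ⨆ d, homogeneousCommSpan 𝒜 U d) (hU hu) ?_ ?_ ?_
  · intro p u hu
    refine Submodule.iSup_induction (fun d => U ⊓ 𝒜 d)
      (motive := fun v => u * v - v * u ∈ ⨆ d, homogeneousCommSpan 𝒜 U d) (hU hv) ?_ ?_ ?_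
    · intro q v hv
      exact Submodule.mem_iSup_of_mem (p + q)
        (Submodule.subset_span ⟨p, q, rfl, u, hu, v, hv, rfl⟩)
    · simp
    · intro x y hx hy
      rw [show u * (x + y) - (x + y) * u = (u * x - x * u) + (u * y - y * u) by noncomm_ring]
      exact add_mem hx hy
  · simp
  · intro x y hx hy
    rw [show (x + y) * v - v * (x + y) = (x * v - v * x) + (y * v - v * y) by noncomm_ring]
    exact add_mem hx hy

theorem derivedPower_le_iSup_inf {𝒜 : ℕ → Submodule F A} (hdirect : DirectSum.IsInternal 𝒜)
    (hmul : ∀ p q : ℕ, ∀ x ∈ 𝒜 p, ∀ y ∈ 𝒜 q, x * y ∈ 𝒜 (p + q)) (i : ℕ) :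
    derivedPower F A i ≤ ⨆ d, derivedPower F A i ⊓ 𝒜 d := by
  induction i with
  | zero =>
    simp only [derivedPower, top_inf_eq, hdirect.submodule_iSup_eq_top, le_refl]
  | succ i ih =>
    exact (commSpan_le_iSup_homogeneousCommSpan ih).trans
      (iSup_mono fun d => homogeneousCommSpan_le hmul _ d)

theorem mem_homogeneousCommSpan {𝒜 : ℕ → Submodule F A} (hdirect : DirectSum.IsInternal 𝒜)
    (hmul : ∀ p q : ℕ, ∀ x ∈ 𝒜 p, ∀ y ∈ 𝒜 q, x * y ∈ 𝒜 (p + q)) {i d : ℕ} {x : A}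
    (hx : x ∈ derivedPower F A (i + 1)) (hxd : x ∈ 𝒜 d) :
    x ∈ homogeneousCommSpan 𝒜 (derivedPower F A i) d :=
  mem_of_mem_iSup_of_mem hdirect
    (fun e => (homogeneousCommSpan_le hmul _ e).trans inf_le_right)
    (commSpan_le_iSup_homogeneousCommSpan (derivedPower_le_iSup_inf hdirect hmul i) hx) hxd

theorem graded_succ_le_subPow {𝒜 : ℕ → Submodule F A} (hdirect : DirectSum.IsInternal 𝒜)
    (hmul : ∀ p q : ℕ, ∀ x ∈ 𝒜 p, ∀ y ∈ 𝒜 q, x * y ∈ 𝒜 (p + q))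
    (hgen : algClosure F (𝒜 1 : Set A) = ⊤) (m : ℕ) :
    𝒜 (m + 1) ≤ subPow F (𝒜 1) m := by
  let B : ℕ → Submodule F A := fun d => Nat.casesOn d ⊥ (subPow F (𝒜 1))
  have hB : ∀ d, B d ≤ 𝒜 d := by
    rintro (_ | d)
    · exact bot_le
    change subPow F (𝒜 1) d ≤ 𝒜 (d + 1)
    induction d with
    | zero => exact le_rfl
    | succ d ih =>
      refine Submodule.span_le.2 ?_
      rintro _ ⟨u, hu, v, hv, rfl⟩
      rw [add_comm (d + 1)]
      exact hmul 1 (d + 1) u hu v (ih hv)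
  have hBmul : ∀ x ∈ ⨆ d, B d, ∀ y ∈ ⨆ d, B d, x * y ∈ ⨆ d, B d := by
    intro x hx y hy
    refine Submodule.iSup_induction B (motive := fun x => x * y ∈ ⨆ d, B d) hx ?_ ?_ ?_
    · intro p x hx
      refine Submodule.iSup_induction B (motive := fun y => x * y ∈ ⨆ d, B d) hy ?_ ?_ ?_
      · intro q y hy
        cases p with
        | zero => rw [(Submodule.mem_bot F).1 hx, zero_mul]; exact zero_mem _
        | succ p =>
          cases q with
          | zero => rw [(Submodule.mem_bot F).1 hy, mul_zero]; exact zero_mem _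
          | succ q => exact Submodule.mem_iSup_of_mem (p + q + 1 + 1) (mul_mem_subPow hx hy)
      · simp
      · intro a b ha hb
        rw [mul_add]
        exact add_mem ha hb
    · simp
    · intro a b ha hb
      rw [add_mul]
      exact add_mem ha hb
  have htop : (⊤ : Submodule F A) ≤ ⨆ d, B d := by
    rw [← hgen]
    exact sInf_le ⟨fun x hx => Submodule.mem_iSup_of_mem 1 hx, hBmul⟩
  exact fun x hx => mem_of_mem_iSup_of_mem hdirect hB (htop Submodule.mem_top) hx

theorem derivedPower_one_inf_le_derivedPower {𝒜 : ℕ → Submodule F A}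
    (hdirect : DirectSum.IsInternal 𝒜)
    (hmul : ∀ p q : ℕ, ∀ x ∈ 𝒜 p, ∀ y ∈ 𝒜 q, x * y ∈ 𝒜 (p + q))
    (hgen : algClosure F (𝒜 1 : Set A) = ⊤) {j n : ℕ}
    (hn : subPow F (⊤ : Submodule F A) n ≤ algIdealGen F (derivedPower F A (j + 1) : Set A))
    {d : ℕ} (hd : 2 * n + 2 ≤ d) : derivedPower F A 1 ⊓ 𝒜 d ≤ derivedPower F A j := by
  have hT : ∀ m, n + 1 ≤ m → 𝒜 m ≤ commTransporter (derivedPower F A j) := by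
    intro m hm
    obtain ⟨m, rfl⟩ : ∃ k, m = k + 1 := ⟨m - 1, by omega⟩
    calc 𝒜 (m + 1) ≤ subPow F (𝒜 1) m := graded_succ_le_subPow hdirect hmul hgen m
      _ ≤ subPow F ⊤ m := subPow_mono le_top m
      _ ≤ subPow F ⊤ n := subPow_top_antitone (by omega)
      _ ≤ _ := hn
      _ ≤ _ := algIdealGen_commSpan_le_commTransporter
        fun u hu a => derivedPower_commutator_mem j hu a
  rintro x ⟨hx, hxd⟩
  refine Submodule.span_le.2 ?_ (mem_homogeneousCommSpan hdirect hmul hx hxd)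
  rintro _ ⟨p, q, hpq, u, hu, v, hv, rfl⟩
  rcases le_or_gt (n + 1) p with hp | hp
  · exact hT p hp hu.2 v
  · rw [← neg_sub]
    exact neg_mem (hT q (by omega) hv.2 u)

end DerivedPowers

/-- Let `A` be a finitely graded associative algebra over a field of
characteristic `≠ 2` (`A = A₁ ⊕ A₂ ⊕ ⋯`, `Aᵢ Aⱼ ⊆ A_{i+j}`, `A` generated by `A₁`,
`dim A₁ < ∞`).  If all the quotients `A / id_A(A^{[i]})`, `i ≥ 1`, are nilpotent — i.e.
for every `i ≥ 1` some power `Aⁿ` is contained in `id_A(A^{[i]})` — then every Lie derived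
power `A^{[i]}`, `i ≥ 1`, is a finitely generated Lie algebra. -/
theorem derivedPower_finitelyGenerated_of_finitelyGraded
    (F : Type*) [Field F] (hchar : ringChar F ≠ 2)
    (A : Type*) [NonUnitalRing A] [Module F A] [SMulCommClass F A A] [IsScalarTower F A A]
    (𝒜 : ℕ → Submodule F A) (h0 : 𝒜 0 = ⊥)
    (hdirect : DirectSum.IsInternal 𝒜)
    (hmul : ∀ p q : ℕ, ∀ x ∈ 𝒜 p, ∀ y ∈ 𝒜 q, x * y ∈ 𝒜 (p + q))
    (hgen : algClosure F (𝒜 1 : Set A) = ⊤)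
    (hfin : FiniteDimensional F (𝒜 1))
    (hnilquot : ∀ i : ℕ, 1 ≤ i →
      ∃ n : ℕ, subPow F (⊤ : Submodule F A) n ≤ algIdealGen F (derivedPower F A i : Set A))
    (i : ℕ) (hi : 1 ≤ i) :
    ∃ T : Finset A, (↑T : Set A) ⊆ (derivedPower F A i : Set A) ∧
      lieClosure F (↑T : Set A) = derivedPower F A i := by
  classical
  obtain ⟨n, hn⟩ := hnilquot (i + 2) (by omega)
  have hfg : ∀ d, (derivedPower F A i ⊓ 𝒜 d).FG := by
    intro d
    have : FiniteDimensional F (𝒜 d) := by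
      cases d with
      | zero => rw [h0]; infer_instance
      | succ m =>
        have := Submodule.fg_iff_finiteDimensional _ |>.1
          (subPow_fg ((Submodule.fg_iff_finiteDimensional _).2 hfin) m)
        exact Submodule.finiteDimensional_of_le (graded_succ_le_subPow hdirect hmul hgen m)
    exact (Submodule.fg_iff_finiteDimensional _).2
      (Submodule.finiteDimensional_of_le inf_le_right)
  choose S hS using hfg
  have hSU (d : ℕ) {x : A} (hx : x ∈ S d) : x ∈ derivedPower F A i :=
    (hS d ▸ Submodule.subset_span hx : x ∈ derivedPower F A i ⊓ 𝒜 d).1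
  have hTU : (↑((Finset.range (2 * n + 2)).biUnion S) : Set A) ⊆ derivedPower F A i := by
    intro x hx
    obtain ⟨d, _, hxd⟩ := Finset.mem_biUnion.1 hx
    exact hSU d hxd
  refine ⟨(Finset.range (2 * n + 2)).biUnion S, hTU, le_antisymm ?_ ?_⟩
  · refine sInf_le ⟨hTU, fun x hx y _ => derivedPower_commutator_mem i hx y⟩
  · refine (derivedPower_le_iSup_inf hdirect hmul i).trans (iSup_le fun d => ?_)
    induction d using Nat.strong_induction_on with
    | _ d ih =>
      rcases lt_or_ge d (2 * n + 2) with hd | hd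
      · rw [← hS d]
        refine Submodule.span_le.2 fun x hx => subset_lieClosure _ ?_
        exact Finset.mem_biUnion.2 ⟨d, Finset.mem_range.2 hd, hx⟩
      · rintro x ⟨hx, hxd⟩
        have hx' : x ∈ derivedPower F A (i + 1) :=
          derivedPower_one_inf_le_derivedPower hdirect hmul hgen hn hd
            ⟨derivedPower_antitone hi hx, hxd⟩
        refine Submodule.span_le.2 ?_ (mem_homogeneousCommSpan hdirect hmul hx' hxd)
        rintro _ ⟨p, q, hpq, u, hu, v, hv, rfl⟩
        rcases Nat.eq_zero_or_pos p with rfl | hp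
        · have hu0 : u = 0 := by simpa [h0] using hu.2
          simp [hu0]
        rcases Nat.eq_zero_or_pos q with rfl | hq
        · have hv0 : v = 0 := by simpa [h0] using hv.2
          simp [hv0]
        exact commutator_mem_lieClosure (ih p (by omega) hu) (ih q (by omega) hv)
end

section
/- Let A be a finitely generated unital associative algebra over a field of characteristic ≠ 2 containing an idempotent e (e² = e) such that AeA = A(1-e)A = A, where AeA and A(1-e)A denote the two-sided ideals generated by e and 1-e respectively. Then the Lie algebra [A,A] (the span of all commutators ab - ba, a,b ∈ A) is a finitely generated Lie algebra. -/
section AlternatingWords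

variable {F A ι κ : Type*} [Field F] [Ring A] [Algebra F A]

/-- The product `x i₁ * y j₁ * ⋯ * x iₙ * y jₙ * x i`, where `l = [(i₁, j₁), …, (iₙ, jₙ)]`. -/
def alternatingWord (x : ι → A) (y : κ → A) (l : List (ι × κ)) (i : ι) : A :=
  (l.map fun p => x p.1 * y p.2).prod * x i

lemma alternatingWord_cons (x : ι → A) (y : κ → A) (p : ι × κ) (l : List (ι × κ)) (i : ι) :
    alternatingWord x y (p :: l) i = x p.1 * y p.2 * alternatingWord x y l i := by
  simp [alternatingWord, mul_assoc]

lemma alternatingWord_append_cons (x : ι → A) (y : κ → A) (l : List (ι × κ)) (p : ι × κ)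
    (l' : List (ι × κ)) (i : ι) :
    alternatingWord x y (l ++ p :: l') i =
      alternatingWord x y l p.1 * y p.2 * alternatingWord x y l' i := by
  simp [alternatingWord, mul_assoc]

lemma mul_alternatingWord {x : ι → A} {e : A} (hx : ∀ i, e * x i = x i) (y : κ → A)
    (l : List (ι × κ)) (i : ι) : e * alternatingWord x y l i = alternatingWord x y l i := by
  cases l with
  | nil => simp [alternatingWord, hx]
  | cons p l => rw [alternatingWord_cons, ← mul_assoc, ← mul_assoc, hx]

lemma alternatingWord_mul {x : ι → A} {f : A} (hx : ∀ i, x i * f = x i) (y : κ → A)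
    (l : List (ι × κ)) (i : ι) : alternatingWord x y l i * f = alternatingWord x y l i := by
  rw [alternatingWord, mul_assoc, hx]

lemma List.exists_split_of_not_nodup_map {α β : Type*} (g : α → β) (l : List α)
    (h : ¬ (l.map g).Nodup) :
    ∃ l₁ p l₂ q l₃, l = l₁ ++ p :: (l₂ ++ q :: l₃) ∧ g p = g q := by
  induction l with
  | nil => simp at h
  | cons a l ih =>
    rw [List.map_cons, List.nodup_cons, not_and_or, not_not] at h
    rcases h with h | h
    · obtain ⟨q, hq, hqa⟩ := List.mem_map.1 h
      obtain ⟨s, t, rfl⟩ := List.append_of_mem hq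
      exact ⟨[], a, s, q, t, rfl, hqa.symm⟩
    · obtain ⟨l₁, p, l₂, q, l₃, rfl, hpq⟩ := ih h
      exact ⟨a :: l₁, p, l₂, q, l₃, rfl, hpq⟩

/-- A space closed under commutators is closed under the Jordan triple product
`u * b * v + v * b * u` whenever `u * v = v * u = 0`. -/
lemma jordan_triple_mem {p : Submodule F A} (hp : ∀ a ∈ p, ∀ b ∈ p, a * b - b * a ∈ p)
    {u b v : A} (hu : u ∈ p) (hb : b ∈ p) (hv : v ∈ p) (huv : u * v = 0) (hvu : v * u = 0) :
    u * b * v + v * b * u ∈ p := by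
  have h := hp _ (hp u hu b hb) v hv
  have h' : (u * b - b * u) * v - v * (u * b - b * u) =
      u * b * v + v * b * u - b * (u * v) - (v * u) * b := by noncomm_ring
  rwa [h', huv, hvu, mul_zero, zero_mul, sub_zero, sub_zero] at h

/-- In characteristic not two, a space closed under commutators that contains the letters `y j` and
the short alternating words contains all alternating words. -/
lemma alternatingWord_mem [Fintype κ] (h2 : (2 : F) ≠ 0) {e f : A} (hfe : f * e = 0)
    {x : ι → A} {y : κ → A} (hex : ∀ i, e * x i = x i) (hxf : ∀ i, x i * f = x i)
    {p : Submodule F A} (hp : ∀ a ∈ p, ∀ b ∈ p, a * b - b * a ∈ p) (hy : ∀ j, y j ∈ p)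
    (hshort : ∀ l i, l.length ≤ Fintype.card κ → alternatingWord x y l i ∈ p)
    (l : List (ι × κ)) (i : ι) : alternatingWord x y l i ∈ p := by
  have hzero (l l' i i') : alternatingWord x y l i * alternatingWord x y l' i' = 0 := by
    rw [← alternatingWord_mul hxf, ← mul_alternatingWord hex y l', mul_assoc, ← mul_assoc f, hfe,
      zero_mul, mul_zero]
  induction hn : l.length using Nat.strong_induction_on generalizing l i with
  | _ n ih =>
  subst hn
  by_cases hl : l.length ≤ Fintype.card κ
  · exact hshort l i hl
  have hdup : ¬ (l.map Prod.snd).Nodup := fun h => hl (by simpa using h.length_le_card)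
  obtain ⟨l₁, q, l₂, r, l₃, rfl, hqr⟩ := List.exists_split_of_not_nodup_map _ _ hdup
  have key (m m' : List (ι × κ)) (i i' : ι)
      (hm : m.length < (l₁ ++ q :: (l₂ ++ r :: l₃)).length)
      (hm' : m'.length < (l₁ ++ q :: (l₂ ++ r :: l₃)).length) :
      alternatingWord x y m i * y q.2 * alternatingWord x y m' i' +
        alternatingWord x y m' i' * y q.2 * alternatingWord x y m i ∈ p :=
    jordan_triple_mem hp (ih _ hm _ _ rfl) (hy _) (ih _ hm' _ _ rfl) (hzero ..) (hzero ..)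
  have h1 := key (l₁ ++ q :: l₂) l₃ r.1 i (by simp) (by simp; omega)
  have h2' := key (l₃ ++ (i, q.2) :: l₁) l₂ q.1 r.1 (by simp; omega) (by simp; omega)
  have h3 := key (l₂ ++ r :: l₃) l₁ i q.1 (by simp; omega) (by simp)
  simp only [alternatingWord_append_cons, ← hqr] at h1 h2' h3 ⊢
  have h := p.smul_mem (2 : F)⁻¹ (p.add_mem (p.sub_mem h1 h2') h3)
  convert h using 1
  rw [eq_inv_smul_iff₀ h2, two_smul]
  noncomm_ring

/-- If the letters `x i ∈ eAf` and `y j ∈ fAe` generate `A`, then `eAf` is spanned by alternating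
words. -/
lemma peirce_mem_of_alternatingWord_mem {e f : A} (hef : e * f = 0)
    (hfe : f * e = 0) {x : ι → A} {y : κ → A}
    (hex : ∀ i, e * x i = x i) (hxf : ∀ i, x i * f = x i)
    (hfy : ∀ j, f * y j = y j) (hye : ∀ j, y j * e = y j)
    (hgen : Algebra.adjoin F (Set.range x ∪ Set.range y) = ⊤)
    {p : Submodule F A} (hw : ∀ l i, alternatingWord x y l i ∈ p) (a : A) : e * a * f ∈ p := by
  set P : Submodule F A := Submodule.span F {w | ∃ l i, w = alternatingWord x y l i} with hP
  have hxyP (i j) {w : A} (hwP : w ∈ P) : x i * y j * w ∈ P := by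
    induction hwP using Submodule.span_induction with
    | mem w hw =>
      obtain ⟨l, k, rfl⟩ := hw
      exact Submodule.subset_span ⟨(i, j) :: l, k, by rw [alternatingWord_cons]⟩
    | zero => simp
    | add u v _ _ hu hv => rw [mul_add]; exact P.add_mem hu hv
    | smul c u _ hu => rw [mul_smul_comm]; exact P.smul_mem c hu
  have hxx (i k) : x i * x k = 0 := by
    rw [← hxf i, ← hex k, mul_assoc, ← mul_assoc f, hfe, zero_mul, mul_zero]
  have hey (j) : e * y j = 0 := by rw [← hfy j, ← mul_assoc, hef, zero_mul]
  have hmain (m : A) (hm : m ∈ Algebra.adjoin F (Set.range x ∪ Set.range y)) :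
      ∀ b : A, (e * b * f ∈ P ∧ ∀ i, x i * b * f ∈ P) →
        (e * (m * b) * f ∈ P ∧ ∀ i, x i * (m * b) * f ∈ P) := by
    induction hm using Algebra.adjoin_induction with
    | mem m hm =>
      rintro b ⟨hb, hb'⟩
      rcases hm with ⟨k, rfl⟩ | ⟨j, rfl⟩
      · refine ⟨by simpa only [← mul_assoc, hex] using hb' k, fun i => ?_⟩
        rw [← mul_assoc, hxx, zero_mul, zero_mul]
        exact P.zero_mem
      · refine ⟨?_, fun i => ?_⟩
        · rw [← mul_assoc, hey, zero_mul, zero_mul]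
          exact P.zero_mem
        · have h := hxyP i j hb
          rw [← hye j]
          simpa only [mul_assoc] using h
    | algebraMap r =>
      rintro b ⟨hb, hb'⟩
      rw [← Algebra.smul_def]
      simp only [mul_smul_comm, smul_mul_assoc]
      exact ⟨P.smul_mem r hb, fun i => P.smul_mem r (hb' i)⟩
    | add m n _ _ hm hn =>
      intro b hb
      simp only [add_mul, mul_add]
      exact ⟨P.add_mem (hm b hb).1 (hn b hb).1, fun i => P.add_mem ((hm b hb).2 i) ((hn b hb).2 i)⟩
    | mul m n _ _ hm hn =>
      intro b hb
      rw [mul_assoc m]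
      exact hm _ (hn b hb)
  have hPp : P ≤ p := by
    rw [hP, Submodule.span_le]
    rintro _ ⟨l, i, rfl⟩
    exact hw l i
  have h1 := (hmain a (by rw [hgen]; trivial) 1 ⟨by simp [hef], fun i => ?_⟩).1
  · rw [mul_one] at h1
    exact hPp h1
  · rw [mul_one, hxf]
    exact Submodule.subset_span ⟨[], i, by simp [alternatingWord]⟩

end AlternatingWords

section Peirce

variable {F A : Type*} [Field F] [Ring A] [Algebra F A]

lemma TwoSidedIdeal.exists_list_of_mem_span_singleton {R : Type*} [Ring R] {z a : R}
    (ha : a ∈ TwoSidedIdeal.span ({z} : Set R)) :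
    ∃ L : List (R × R), a = (L.map fun q => q.1 * z * q.2).sum := by
  induction ha using TwoSidedIdeal.span_induction with
  | mem a h => exact ⟨[(1, 1)], by simpa using h⟩
  | zero => exact ⟨[], by simp⟩
  | add a b _ _ ha hb =>
    obtain ⟨L, rfl⟩ := ha
    obtain ⟨M, rfl⟩ := hb
    exact ⟨L ++ M, by simp⟩
  | neg a _ ha =>
    obtain ⟨L, rfl⟩ := ha
    refine ⟨L.map fun q => (-q.1, q.2), ?_⟩
    simp [Function.comp_def, List.sum_neg]
  | left_absorb b a _ ha =>
    obtain ⟨L, rfl⟩ := ha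
    refine ⟨L.map fun q => (b * q.1, q.2), ?_⟩
    simp [Function.comp_def, mul_assoc, List.sum_map_mul_left]
  | right_absorb b a _ ha =>
    obtain ⟨L, rfl⟩ := ha
    refine ⟨L.map fun q => (q.1, q.2 * b), ?_⟩
    simp only [List.map_map, Function.comp_def, ← mul_assoc, List.sum_map_mul_right]

/-- If `e = ∑ a * f * b`, then `e * s * e` lies in any subalgebra containing all
`e * (s * (e * a)) * f` and `f * b * e`. -/
lemma peirce_diag_mem {e f : A} (he : e * e = e) (hf : f * f = f) {B : Subalgebra F A}
    {L : List (A × A)} (hL : e = (L.map fun q => q.1 * f * q.2).sum) (s : A)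
    (h1 : ∀ q ∈ L, e * (s * (e * q.1)) * f ∈ B) (h2 : ∀ q ∈ L, f * (q.2 * 1) * e ∈ B) :
    e * s * e ∈ B := by
  have h : e * s * e = (L.map fun q => e * (s * (e * q.1)) * f * (f * (q.2 * 1) * e)).sum := by
    calc e * s * e = e * s * e * e * e := by simp only [mul_assoc, he]
      _ = e * s * e * (L.map fun q => q.1 * f * q.2).sum * e := by rw [← hL]
      _ = _ := by
        rw [← List.sum_map_mul_left, ← List.sum_map_mul_right]
        refine congrArg List.sum (List.map_congr_left fun q _ => ?_)
        simp only [mul_assoc, mul_one]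
        rw [← mul_assoc f f, hf]
  rw [h]
  refine list_sum_mem fun w hw => ?_
  obtain ⟨q, hq, rfl⟩ := List.mem_map.1 hw
  exact B.mul_mem (h1 q hq) (h2 q hq)

/-- A finitely generated algebra with full complementary idempotents `e` and `f` is generated by
finitely many elements of `eAf ∪ fAe`. -/
lemma exists_finset_adjoin_peirce_eq_top {S : Finset A} (hS : Algebra.adjoin F (S : Set A) = ⊤)
    {e f : A} (he : e * e = e) (hf : f * f = f) (hsum : e + f = 1)
    (he1 : TwoSidedIdeal.span ({e} : Set A) = ⊤) (hf1 : TwoSidedIdeal.span ({f} : Set A) = ⊤) :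
    ∃ G : Finset A, Algebra.adjoin F
      ((Set.range fun s : G × G => e * (s.1 * s.2 : A) * f) ∪
        Set.range fun s : G × G => f * (s.1 * s.2 : A) * e) = ⊤ := by
  classical
  obtain ⟨L, hL⟩ := TwoSidedIdeal.exists_list_of_mem_span_singleton
    (z := f) (a := e) (by rw [hf1]; trivial)
  obtain ⟨M, hM⟩ := TwoSidedIdeal.exists_list_of_mem_span_singleton
    (z := e) (a := f) (by rw [he1]; trivial)
  let G : Finset A := insert 1 (S ∪ (L.map fun q => e * q.1).toFinset ∪
    (L.map fun q => q.2).toFinset ∪ (M.map fun q => f * q.1).toFinset ∪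
    (M.map fun q => q.2).toFinset)
  have hG1 : (1 : A) ∈ G := Finset.mem_insert_self _ _
  have hGS {s} (hs : s ∈ S) : s ∈ G := by simp [G, hs]
  have hL1 (q) (hq : q ∈ L) : e * q.1 ∈ G := by
    have := List.mem_map_of_mem (f := fun q : A × A => e * q.1) hq
    simp only [G, Finset.mem_insert, Finset.mem_union, List.mem_toFinset]; tauto
  have hL2 (q) (hq : q ∈ L) : q.2 ∈ G := by
    have := List.mem_map_of_mem (f := fun q : A × A => q.2) hq
    simp only [G, Finset.mem_insert, Finset.mem_union, List.mem_toFinset]; tauto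
  have hM1 (q) (hq : q ∈ M) : f * q.1 ∈ G := by
    have := List.mem_map_of_mem (f := fun q : A × A => f * q.1) hq
    simp only [G, Finset.mem_insert, Finset.mem_union, List.mem_toFinset]; tauto
  have hM2 (q) (hq : q ∈ M) : q.2 ∈ G := by
    have := List.mem_map_of_mem (f := fun q : A × A => q.2) hq
    simp only [G, Finset.mem_insert, Finset.mem_union, List.mem_toFinset]; tauto
  refine ⟨G, ?_⟩
  set B := Algebra.adjoin F ((Set.range fun s : G × G => e * (s.1 * s.2 : A) * f) ∪
        Set.range fun s : G × G => f * (s.1 * s.2 : A) * e)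
  have hx {s t : A} (hs : s ∈ G) (ht : t ∈ G) : e * (s * t) * f ∈ B :=
    Algebra.subset_adjoin (Or.inl ⟨(⟨s, hs⟩, ⟨t, ht⟩), rfl⟩)
  have hy {s t : A} (hs : s ∈ G) (ht : t ∈ G) : f * (s * t) * e ∈ B :=
    Algebra.subset_adjoin (Or.inr ⟨(⟨s, hs⟩, ⟨t, ht⟩), rfl⟩)
  rw [eq_top_iff, ← hS]
  refine Algebra.adjoin_le fun s hs => ?_
  have hs' : s ∈ G := hGS hs
  have h11 := peirce_diag_mem (B := B) he hf hL s (fun q hq => hx hs' (hL1 q hq))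
    (fun q hq => hy (hL2 q hq) hG1)
  have h22 := peirce_diag_mem (B := B) hf he hM s (fun q hq => hy hs' (hM1 q hq))
    (fun q hq => hx (hM2 q hq) hG1)
  have h12 := hx hs' hG1
  have h21 := hy hs' hG1
  rw [mul_one] at h12 h21
  have hdecomp : s = e * s * e + e * s * f + (f * s * e + f * s * f) := by
    rw [← mul_add, ← mul_add, hsum, mul_one, mul_one, ← add_mul, hsum, one_mul]
  rw [hdecomp]
  exact B.add_mem (B.add_mem h11 h12) (B.add_mem h21 h22)

/-- If `p` is closed under commutators and contains `eAf` and `fAe`, then it contains the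
commutators of all elements of `eAf`. -/
lemma commutator_mem_of_peirce {e f : A} (hsum : e + f = 1) {p : Submodule F A}
    (hp : ∀ a ∈ p, ∀ b ∈ p, a * b - b * a ∈ p) (hef : ∀ a, e * a * f ∈ p)
    (hfe : ∀ a, f * a * e ∈ p) {x : A} (hex : e * x = x) (hxf : x * f = x) (v : A) : x * v - v * x ∈ p := by
  have hx : x ∈ p := by simpa [hex, hxf] using hef x
  have h1 := hp x hx _ (hfe v)
  have h2 := hef (x * v)
  have h3 := hef (v * x)
  have h : x * v - v * x = (x * (f * v * e) - f * v * e * x) + e * (x * v) * f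
      - e * (v * x) * f := by
    have e1 : x * (f * v * e) = x * v * e := by rw [← mul_assoc, ← mul_assoc, hxf]
    have e2 : f * v * e * x = f * (v * x) := by rw [mul_assoc, mul_assoc, hex]
    have e3 : e * (x * v) * f = x * v * f := by rw [← mul_assoc, hex]
    have e4 : e * (v * x) * f = e * (v * x) := by rw [mul_assoc, mul_assoc v, hxf]
    rw [e1, e2, e3, e4]
    calc x * v - v * x = x * v * (e + f) - (e + f) * (v * x) := by rw [hsum, mul_one, one_mul]
      _ = _ := by noncomm_ring
  rw [h]
  exact p.sub_mem (p.add_mem h1 h2) h3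

end Peirce

/-- Let `A` be a finitely generated unital associative algebra over a field
of characteristic `≠ 2` with an idempotent `e` such that `AeA = A(1-e)A = A`.  Then the Lie
algebra `[A, A]` (the span of all commutators) is finitely generated. -/
theorem commutator_finitelyGenerated_of_idempotent
    (F : Type*) [Field F] (hchar : ringChar F ≠ 2)
    (A : Type*) [Ring A] [Algebra F A]
    (hfg : ∃ S : Finset A, Algebra.adjoin F (↑S : Set A) = ⊤)
    (e : A) (he : e * e = e)
    (he1 : TwoSidedIdeal.span ({e} : Set A) = ⊤)
    (he2 : TwoSidedIdeal.span ({1 - e} : Set A) = ⊤) :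
    ∃ T : Finset A, (↑T : Set A) ⊆ (commSpan F (⊤ : Submodule F A) ⊤ : Set A) ∧
      lieClosure F (↑T : Set A) = commSpan F (⊤ : Submodule F A) ⊤ := by
  classical
  have h2 : (2 : F) ≠ 0 := Ring.two_ne_zero hchar
  obtain ⟨S, hS⟩ := hfg
  obtain ⟨f, hfdef⟩ : ∃ f, f = 1 - e := ⟨_, rfl⟩
  rw [← hfdef] at he2
  have hsum : e + f = 1 := by rw [hfdef, add_sub_cancel]
  have hef : e * f = 0 := by rw [hfdef, mul_sub, mul_one, he, sub_self]
  have hfe : f * e = 0 := by rw [hfdef, sub_mul, one_mul, he, sub_self]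
  have hf : f * f = f := by
    calc f * f = (e + f) * f := by rw [add_mul, hef, zero_add]
      _ = f := by rw [hsum, one_mul]
  obtain ⟨G, hG⟩ := exists_finset_adjoin_peirce_eq_top hS he hf hsum he1 he2
  set x : G × G → A := fun s => e * (s.1 * s.2 : A) * f with hx
  set y : G × G → A := fun s => f * (s.1 * s.2 : A) * e with hy
  have hex (i) : e * x i = x i := by simp only [hx, ← mul_assoc, he]
  have hxf (i) : x i * f = x i := by simp only [hx, mul_assoc, hf]
  have hfy (i) : f * y i = y i := by simp only [hy, ← mul_assoc, hf]
  have hye (i) : y i * e = y i := by simp only [hy, mul_assoc, he]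
  have hG' : Algebra.adjoin F (Set.range y ∪ Set.range x) = ⊤ := by rw [Set.union_comm, hG]
  have hfin := List.finite_length_le ((G × G) × (G × G)) (Fintype.card (G × G))
  let W : Finset ((List ((G × G) × (G × G))) × (G × G)) := hfin.toFinset ×ˢ Finset.univ
  have hW {l i} (hl : l.length ≤ Fintype.card (G × G)) : (l, i) ∈ W := by
    rw [Finset.mem_product, Set.Finite.mem_toFinset]
    exact ⟨hl, Finset.mem_univ _⟩
  have hcomm (u v : A) : u * v - v * u ∈ commSpan F (⊤ : Submodule F A) ⊤ :=
    Submodule.subset_span ⟨u, trivial, v, trivial, rfl⟩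
  have hT : (↑(W.image (fun w => alternatingWord x y w.1 w.2) ∪
      W.image (fun w => alternatingWord y x w.1 w.2)) : Set A) ⊆
      (commSpan F (⊤ : Submodule F A) ⊤ : Set A) := by
    intro t ht
    rw [Finset.mem_coe, Finset.mem_union, Finset.mem_image, Finset.mem_image] at ht
    rcases ht with ⟨w, -, rfl⟩ | ⟨w, -, rfl⟩
    · have h := hcomm e (alternatingWord x y w.1 w.2)
      rwa [mul_alternatingWord hex, ← alternatingWord_mul hxf, mul_assoc, hfe, mul_zero,
        sub_zero, alternatingWord_mul hxf] at h
    · have h := hcomm f (alternatingWord y x w.1 w.2)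
      rwa [mul_alternatingWord hfy, ← alternatingWord_mul hye, mul_assoc, hef, mul_zero,
        sub_zero, alternatingWord_mul hye] at h
  refine ⟨_, hT, le_antisymm (sInf_le ⟨hT, fun u _ v _ => hcomm u v⟩) (le_sInf ?_)⟩
  rintro p ⟨hTp, hp⟩
  have hxshort (l i) (hl : l.length ≤ Fintype.card (G × G)) : alternatingWord x y l i ∈ p :=
    hTp (Finset.mem_union_left _ (Finset.mem_image_of_mem _ (hW hl)))
  have hyshort (l i) (hl : l.length ≤ Fintype.card (G × G)) : alternatingWord y x l i ∈ p :=
    hTp (Finset.mem_union_right _ (Finset.mem_image_of_mem _ (hW hl)))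
  have hxp (i) : x i ∈ p := by simpa [alternatingWord] using hxshort [] i (Nat.zero_le _)
  have hyp (i) : y i ∈ p := by simpa [alternatingWord] using hyshort [] i (Nat.zero_le _)
  have hp12 : ∀ a, e * a * f ∈ p := peirce_mem_of_alternatingWord_mem hef hfe hex hxf hfy hye hG
    (alternatingWord_mem h2 hfe hex hxf hp hyp hxshort)
  have hp21 : ∀ a, f * a * e ∈ p := peirce_mem_of_alternatingWord_mem hfe hef hfy hye hex hxf hG'
    (alternatingWord_mem h2 hef hfy hye hp hxp hyshort)
  have hmain (u : A) (hu : u ∈ Algebra.adjoin F (Set.range x ∪ Set.range y)) :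
      ∀ v, u * v - v * u ∈ p := by
    induction hu using Algebra.adjoin_induction with
    | mem u hu =>
      rcases hu with ⟨i, rfl⟩ | ⟨i, rfl⟩
      · exact commutator_mem_of_peirce hsum hp hp12 hp21 (hex i) (hxf i)
      · exact commutator_mem_of_peirce (by rw [add_comm, hsum]) hp hp21 hp12 (hfy i) (hye i)
    | algebraMap r =>
      intro v
      rw [Algebra.commutes, sub_self]
      exact p.zero_mem
    | add a b _ _ ha hb =>
      intro v
      convert p.add_mem (ha v) (hb v) using 1
      noncomm_ring
    | mul a b _ _ ha hb =>
      intro v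
      convert p.add_mem (ha (b * v)) (hb (v * a)) using 1
      noncomm_ring
  refine Submodule.span_le.2 ?_
  rintro _ ⟨u, -, v, -, rfl⟩
  exact hmain u (by rw [hG]; trivial) v
end

section
/- Let A be a unital associative algebra over a field with an idempotent e (e² = e). Then the conditions AeA = A and A(1-e)A = A both hold if and only if A is generated as an associative algebra by the set eA(1-e) ∪ (1-e)Ae. -/
section algClosure

variable {F : Type*} [Field F] {A : Type*}

theorem subset_algClosure [NonUnitalRing A] [Module F A] [SMulCommClass F A A]
    [IsScalarTower F A A] (S : Set A) : S ⊆ (algClosure F S : Set A) :=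
  fun _ hx => Submodule.mem_sInf.2 fun _ hp => hp.1 hx

theorem mul_mem_algClosure [NonUnitalRing A] [Module F A] [SMulCommClass F A A]
    [IsScalarTower F A A] {S : Set A} {x y : A} (hx : x ∈ algClosure F S)
    (hy : y ∈ algClosure F S) : x * y ∈ algClosure F S :=
  Submodule.mem_sInf.2 fun p hp =>
    hp.2 x (Submodule.mem_sInf.1 hx p hp) y (Submodule.mem_sInf.1 hy p hp)

theorem algClosure_le [NonUnitalRing A] [Module F A] [SMulCommClass F A A]
    [IsScalarTower F A A] {S : Set A} {p : Submodule F A} (hS : S ⊆ p)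
    (hmul : ∀ x ∈ p, ∀ y ∈ p, x * y ∈ p) : algClosure F S ≤ p :=
  sInf_le ⟨hS, hmul⟩

variable [Ring A] [Algebra F A]

/-- A two-sided ideal containing a set that generates `A` is everything. -/
theorem TwoSidedIdeal.eq_top_of_algClosure_eq_top {S : Set A} (hS : algClosure F S = ⊤)
    (I : TwoSidedIdeal A) (hI : ∀ x ∈ S, x ∈ I) : I = ⊤ := by
  let p : Submodule F A :=
    { carrier := {x | x ∈ I}
      add_mem' := fun hx hy => I.add_mem hx hy
      zero_mem' := I.zero_mem
      smul_mem' := fun c x hx => by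
        rw [Set.mem_ofPred_eq, Algebra.smul_def]
        exact I.mul_mem_left _ _ hx }
  have hp : algClosure F S ≤ p := algClosure_le hI fun x _ y hy => I.mul_mem_left x y hy
  refine eq_top_iff.2 fun x _ => hp ?_
  rw [hS]
  trivial

/-- If `u A g A v` lies in an additive subgroup `p`, so does `u (A g A) v`. -/
theorem TwoSidedIdeal.mul_mul_mem_of_mem_span_singleton {p : AddSubgroup A} {u v g : A}
    (h : ∀ x y, u * (x * g * y) * v ∈ p) {a : A} (ha : a ∈ TwoSidedIdeal.span ({g} : Set A)) :
    u * a * v ∈ p := by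
  let I : TwoSidedIdeal A := TwoSidedIdeal.mk' {b | ∀ x y, u * (x * b * y) * v ∈ p}
    (fun x y => by simp [p.zero_mem])
    (fun {b c} hb hc x y => by
      simpa only [mul_add, add_mul] using p.add_mem (hb x y) (hc x y))
    (fun {b} hb x y => by simpa only [mul_neg, neg_mul] using p.neg_mem (hb x y))
    (fun {b c} hc x y => by simpa only [mul_assoc] using hc (x * b) y)
    (fun {b c} hb x y => by simpa only [mul_assoc] using hb x (c * y))
  have haI : a ∈ I := TwoSidedIdeal.mem_span_iff.1 ha I fun b hb => by
    rw [Set.mem_singleton_iff.1 hb]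
    exact (TwoSidedIdeal.mem_mk' ..).2 h
  simpa using (TwoSidedIdeal.mem_mk' ..).1 haI 1 1

/-- If `A g A = A` for an idempotent `g`, then `u A u` is generated by `u A g` and `g A u`. -/
theorem mul_mul_mem_algClosure {S : Set A} {u g : A} (hg : g * g = g)
    (htop : TwoSidedIdeal.span ({g} : Set A) = ⊤) (hug : ∀ a, u * a * g ∈ S)
    (hgu : ∀ a, g * a * u ∈ S) (a : A) : u * a * u ∈ algClosure F S := by
  refine TwoSidedIdeal.mul_mul_mem_of_mem_span_singleton (p := (algClosure F S).toAddSubgroup)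
    (g := g) (fun x y => ?_) (by rw [htop]; trivial)
  have key : u * (x * g * y) * u = u * x * g * (g * y * u) := by
    calc u * (x * g * y) * u = u * x * g * y * u := by simp only [mul_assoc]
      _ = u * x * (g * g) * y * u := by rw [hg]
      _ = u * x * g * (g * y * u) := by simp only [mul_assoc]
  rw [key]
  exact mul_mem_algClosure (subset_algClosure S (hug x)) (subset_algClosure S (hgu y))

end algClosure

/-- Let `A` be a unital associative algebra over a field with an idempotent
`e`.  Then `AeA = A(1-e)A = A` holds if and only if `A` is generated as an associative
algebra by the Peirce components `eA(1-e) ∪ (1-e)Ae`. -/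
theorem idempotent_ideals_top_iff_generated_by_peirce
    (F : Type*) [Field F]
    (A : Type*) [Ring A] [Algebra F A]
    (e : A) (he : e * e = e) :
    (TwoSidedIdeal.span ({e} : Set A) = ⊤ ∧ TwoSidedIdeal.span ({1 - e} : Set A) = ⊤) ↔
      algClosure F ({x : A | ∃ a : A, x = e * a * (1 - e)} ∪
        {x : A | ∃ a : A, x = (1 - e) * a * e}) = ⊤ := by
  constructor
  · rintro ⟨h₁, h₂⟩
    refine eq_top_iff.2 fun a _ => ?_
    have hf : (1 - e) * (1 - e) = 1 - e := (show IsIdempotentElem e from he).one_sub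
    have decomp : a = e * a * e + (1 - e) * a * (1 - e) + e * a * (1 - e) + (1 - e) * a * e := by
      noncomm_ring
    rw [decomp]
    refine add_mem (add_mem (add_mem ?_ ?_) ?_) ?_
    · exact mul_mul_mem_algClosure hf h₂ (fun b => Or.inl ⟨b, rfl⟩) (fun b => Or.inr ⟨b, rfl⟩) a
    · exact mul_mul_mem_algClosure he h₁ (fun b => Or.inr ⟨b, rfl⟩) (fun b => Or.inl ⟨b, rfl⟩) a
    · exact subset_algClosure _ (Or.inl ⟨a, rfl⟩)
    · exact subset_algClosure _ (Or.inr ⟨a, rfl⟩)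
  · intro h
    constructor <;> refine TwoSidedIdeal.eq_top_of_algClosure_eq_top h _ ?_
    · have he' : e ∈ TwoSidedIdeal.span ({e} : Set A) := TwoSidedIdeal.subset_span rfl
      rintro _ (⟨a, rfl⟩ | ⟨a, rfl⟩)
      · rw [mul_assoc]
        exact TwoSidedIdeal.mul_mem_right _ _ _ he'
      · exact TwoSidedIdeal.mul_mem_left _ _ _ he'
    · have hf' : 1 - e ∈ TwoSidedIdeal.span ({1 - e} : Set A) := TwoSidedIdeal.subset_span rfl
      rintro _ (⟨a, rfl⟩ | ⟨a, rfl⟩)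
      · exact TwoSidedIdeal.mul_mem_left _ _ _ hf'
      · rw [mul_assoc]
        exact TwoSidedIdeal.mul_mem_right _ _ _ hf'
end

section
/- Let A be an associative algebra over a field and let U be an ideal of the Lie algebra A^(-). Then [U∘U, A] ⊆ U, where U∘U is the linear span of all Jordan products u∘v = uv + vu with u, v ∈ U, and [U∘U, A] is the linear span of all commutators [w, a] = wa - aw with w ∈ U∘U and a ∈ A. -/
/-- The linear span of all Jordan products `u * v + v * u` with `u ∈ U`, `v ∈ V`. -/
def jordanSpan (F : Type*) [Field F] {A : Type*} [NonUnitalRing A] [Module F A]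
    [SMulCommClass F A A] [IsScalarTower F A A] (U V : Submodule F A) : Submodule F A :=
  Submodule.span F {x | ∃ u ∈ U, ∃ v ∈ V, x = u * v + v * u}

/-- Let `A` be an associative algebra over a field and `U` an ideal of the
Lie algebra `A⁽⁻⁾`.  Then `[U∘U, A] ⊆ U`. -/
theorem comm_jordan_subset
    (F : Type*) [Field F]
    (A : Type*) [NonUnitalRing A] [Module F A] [SMulCommClass F A A] [IsScalarTower F A A]
    (U : Submodule F A) (hU : ∀ u ∈ U, ∀ a : A, u * a - a * u ∈ U) :
    commSpan F (jordanSpan F U U) ⊤ ≤ U := by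
  refine Submodule.span_le.2 ?_
  rintro _ ⟨w, hw, a, -, rfl⟩
  simp only [SetLike.mem_coe]
  induction hw using Submodule.span_induction with
  | mem x hx =>
    obtain ⟨u, hu, v, hv, rfl⟩ := hx
    have key : (u * v + v * u) * a - a * (u * v + v * u) =
        (u * (v * a + a * v) - (v * a + a * v) * u) +
          (v * (u * a + a * u) - (u * a + a * u) * v) := by
      simp only [mul_add, add_mul, mul_assoc]
      abel
    rw [key]
    exact U.add_mem (hU u hu _) (hU v hv _)
  | zero => simp
  | add x y _ _ hx hy =>
    have key : (x + y) * a - a * (x + y) = (x * a - a * x) + (y * a - a * y) := by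
      rw [add_mul, mul_add]
      abel
    rw [key]
    exact U.add_mem hx hy
  | smul c x _ hx =>
    rw [smul_mul_assoc, mul_smul_comm, ← smul_sub]
    exact U.smul_mem c hx
end

section
/- Let A be an associative algebra over a field and let U be an ideal of the Lie algebra A^(-). Then [U,U]∘A ⊆ U + U∘U, where [U,U] is the linear span of commutators of pairs of elements of U, ∘ denotes the Jordan product x∘y = xy + yx applied spanwise, and U + U∘U is the sum of subspaces. -/
/-- Let `A` be an associative algebra over a field and `U` an ideal of the
Lie algebra `A⁽⁻⁾`.  Then `[U,U]∘A ⊆ U + U∘U`. -/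
theorem jordan_comm_subset
    (F : Type*) [Field F]
    (A : Type*) [NonUnitalRing A] [Module F A] [SMulCommClass F A A] [IsScalarTower F A A]
    (U : Submodule F A) (hU : ∀ u ∈ U, ∀ a : A, u * a - a * u ∈ U) :
    jordanSpan F (commSpan F U U) ⊤ ≤ U ⊔ jordanSpan F U U := by
  refine Submodule.span_le.2 ?_
  rintro _ ⟨w, hw, a, -, rfl⟩
  induction hw using Submodule.span_induction with
  | mem w hw =>
    obtain ⟨u, hu, v, hv, rfl⟩ := hw
    have key : (u * v - v * u) * a + a * (u * v - v * u) =
        (u * (v * a + a * v) - (v * a + a * v) * u) -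
          (v * (u * a - a * u) + (u * a - a * u) * v) := by
      noncomm_ring
    rw [key]
    exact sub_mem (Submodule.mem_sup_left (hU u hu _))
      (Submodule.mem_sup_right (Submodule.subset_span ⟨v, hv, _, hU u hu a, rfl⟩))
  | zero => simp
  | add x y _ _ hx hy =>
    have h := add_mem hx hy
    rwa [add_add_add_comm, ← add_mul, ← mul_add] at h
  | smul c x _ hx =>
    have h := Submodule.smul_mem _ c hx
    rwa [smul_add, ← smul_mul_assoc, ← mul_smul_comm] at h
end

section
/- Let B be a finitely generated unital associative algebra over a field of characteristic ≠ 2 satisfying the polynomial identity f_k(x_1, …, x_{2^k}) = 0 for some k ≥ 1, where f_1(x_1,x_2) = [x_1,x_2] and f_s(x_1,…,x_{2^s}) = [f_{s-1}(x_1,…,x_{2^{s-1}}), f_{s-1}(x_{2^{s-1}+1},…,x_{2^s})] for s ≥ 2. Then the quotient B / J(B) of B by its Jacobson radical J(B) is commutative. -/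
/-- The iterated commutator polynomials evaluated in a ring:
`fk 0 x = x 0` and
`fk (s+1) x = [fk s (x 0, …, x (2^s - 1)), fk s (x 2^s, …, x (2^(s+1) - 1))]`,
so that `fk k` is the polynomial `f_k(x_1, …, x_{2^k})` of the paper
(`f_1(x₁,x₂) = [x₁,x₂]`, `f_s = [f_{s-1}, f_{s-1}]` in disjoint variables). -/
def fk {B : Type*} [Ring B] : ℕ → (ℕ → B) → B
  | 0, x => x 0
  | s + 1, x =>
      fk s x * fk s (fun j => x (j + 2 ^ s)) - fk s (fun j => x (j + 2 ^ s)) * fk s x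

attribute [local instance] LieRing.ofAssociativeRing

lemma fk_congr {R : Type*} [Ring R] (s : ℕ) {x y : ℕ → R} (h : ∀ j < 2 ^ s, x j = y j) :
    fk s x = fk s y := by
  induction s generalizing x y with
  | zero => exact h 0 (by simp)
  | succ s ih =>
    have h₁ : fk s x = fk s y := ih fun j hj => h j (by rw [pow_succ]; omega)
    have h₂ : fk s (fun j => x (j + 2 ^ s)) = fk s (fun j => y (j + 2 ^ s)) :=
      ih fun j hj => h _ (by rw [pow_succ]; omega)
    simp only [fk, h₁, h₂]

lemma map_fk {R S : Type*} [Ring R] [Ring S] (f : R →+* S) (s : ℕ) (x : ℕ → R) :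
    f (fk s x) = fk s (fun j => f (x j)) := by
  induction s generalizing x with
  | zero => rfl
  | succ s ih => simp only [fk, map_sub, map_mul, ih]

lemma exists_fk_succ_eq_lie {R : Type*} [Ring R] (s : ℕ) (x y : ℕ → R) :
    ∃ z : ℕ → R, fk (s + 1) z = ⁅fk s x, fk s y⁆ := by
  refine ⟨fun j => if j < 2 ^ s then x j else y (j - 2 ^ s), ?_⟩
  have h₁ : fk s (fun j => if j < 2 ^ s then x j else y (j - 2 ^ s)) = fk s x :=
    fk_congr s fun j hj => if_pos hj
  simp [fk, h₁, Ring.lie_def]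

/-- The derived series of an associative ring is additively spanned by the values of `fk`. -/
lemma derivedSeries_le_span_range_fk {R : Type*} [Ring R] (s : ℕ) :
    (LieAlgebra.derivedSeries ℤ R s).toSubmodule ≤ Submodule.span ℤ (Set.range (fk s)) := by
  induction s with
  | zero => exact fun x _ => Submodule.subset_span ⟨fun _ => x, rfl⟩
  | succ s ih =>
    rw [LieAlgebra.derivedSeries_def, LieAlgebra.derivedSeriesOfIdeal_succ,
      LieSubmodule.lieIdeal_oper_eq_linear_span', Submodule.span_le]
    rintro _ ⟨u, hu, v, hv, rfl⟩
    have hu' := ih hu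
    have hv' := ih hv
    clear hu hv
    induction hu', hv' using Submodule.span_induction₂ with
    | mem_mem a b ha hb =>
      obtain ⟨x, rfl⟩ := ha
      obtain ⟨y, rfl⟩ := hb
      exact Submodule.subset_span (exists_fk_succ_eq_lie s x y)
    | zero_left => simp
    | zero_right => simp
    | add_left a b c _ _ _ h₁ h₂ => rw [add_lie]; exact add_mem h₁ h₂
    | add_right a b c _ _ _ h₁ h₂ => rw [lie_add]; exact add_mem h₁ h₂
    | smul_left n a b _ _ h => rw [smul_lie]; exact Submodule.smul_mem _ n h
    | smul_right n a b _ _ h => rw [lie_smul]; exact Submodule.smul_mem _ n h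

section Semiprime

variable {R : Type*} [Ring R] (hprime : ∀ a : R, (∀ r, a * r * a = 0) → a = 0)
  (htwo : ∀ a : R, 2 * a = 0 → a = 0)

include hprime htwo

/-- In a 2-torsion-free semiprime ring, an element whose inner derivation squares to zero
is central. -/
lemma lie_eq_zero_of_lie_lie_eq_zero {a : R} (h : ∀ x : R, ⁅a, ⁅a, x⁆⁆ = 0) (x : R) :
    ⁅a, x⁆ = 0 := by
  have hmul (x y : R) : ⁅a, x⁆ * ⁅a, y⁆ = 0 := by
    apply htwo
    have key : 2 * (⁅a, x⁆ * ⁅a, y⁆) =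
        ⁅a, ⁅a, x * y⁆⁆ - ⁅a, ⁅a, x⁆⁆ * y - x * ⁅a, ⁅a, y⁆⁆ := by
      simp only [Ring.lie_def]; noncomm_ring
    rw [key, h, h, h]; simp
  refine hprime _ fun y => ?_
  have key : ⁅a, x⁆ * y * ⁅a, x⁆ = ⁅a, x⁆ * ⁅a, y * x⁆ - ⁅a, x⁆ * ⁅a, y⁆ * x := by
    simp only [Ring.lie_def]; noncomm_ring
  rw [key, hmul, hmul]; simp

/-- In a 2-torsion-free semiprime ring, `a` is central if `⁅a, ⁅a, x⁆⁆` is central for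
every `x`. -/
lemma lie_eq_zero_of_lie_lie_central {a : R} (h : ∀ x y : R, ⁅⁅a, ⁅a, x⁆⁆, y⁆ = 0) (x : R) :
    ⁅a, x⁆ = 0 := by
  refine lie_eq_zero_of_lie_lie_eq_zero hprime htwo (fun x => ?_) x
  have hmul (y : R) : ⁅a, ⁅a, x⁆⁆ * ⁅a, y⁆ = 0 := by
    have key : ⁅a, ⁅a, x⁆⁆ * ⁅a, y⁆ =
        ⁅⁅a, ⁅a, x * a⁆⁆, y⁆ - ⁅⁅a, ⁅a, x⁆⁆, y⁆ * a := by
      simp only [Ring.lie_def]; noncomm_ring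
    rw [key, h, h]; simp
  refine hprime _ fun r => ?_
  have key : ⁅a, ⁅a, x⁆⁆ * r * ⁅a, ⁅a, x⁆⁆ =
      ⁅⁅a, ⁅a, x⁆⁆, r⁆ * ⁅a, ⁅a, x⁆⁆ + r * (⁅a, ⁅a, x⁆⁆ * ⁅a, ⁅a, x⁆⁆) := by
    rw [Ring.lie_def ⁅a, ⁅a, x⁆⁆ r]; noncomm_ring
  rw [key, h, hmul]; simp

/-- A 2-torsion-free semiprime ring satisfying `fk k = 0` is commutative. -/
lemma commute_of_fk_eq_zero {k : ℕ} (hid : ∀ x : ℕ → R, fk k x = 0) (a b : R) :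
    a * b = b * a := by
  have central : ∀ s ≤ k, ∀ u ∈ LieAlgebra.derivedSeries ℤ R s, ∀ y : R, ⁅u, y⁆ = 0 := by
    intro s hs
    induction hs using Nat.decreasingInduction with
    | self =>
      intro u hu y
      have hspan := derivedSeries_le_span_range_fk k hu
      have hrange : Set.range (fk k : (ℕ → R) → R) ⊆ {0} := by
        rintro _ ⟨x, rfl⟩
        exact hid x
      have hu0 := Submodule.span_mono (R := ℤ) hrange hspan
      rw [Submodule.span_zero_singleton, Submodule.mem_bot] at hu0
      rw [hu0, zero_lie]
    | of_succ s _ ih =>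
      intro u hu
      refine lie_eq_zero_of_lie_lie_central hprime htwo fun x => ih _ ?_
      rw [LieAlgebra.derivedSeries_def, LieAlgebra.derivedSeriesOfIdeal_succ]
      exact LieSubmodule.lie_mem_lie hu (lie_mem_left ℤ R _ u x hu)
  have h := central 0 (Nat.zero_le k) a (by simp) b
  rwa [Ring.lie_def, sub_eq_zero] at h

end Semiprime

/-- The Jacobson radical is a semiprime ideal. -/
lemma mem_jacobson_bot_of_forall_mul_mul_mem {B : Type*} [Ring B] {a : B}
    (h : ∀ r, a * r * a ∈ Ideal.jacobson (⊥ : Ideal B)) : a ∈ Ideal.jacobson (⊥ : Ideal B) := by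
  rw [Ideal.mem_jacobson_iff]
  intro y
  obtain ⟨w, hw⟩ := Ideal.mem_jacobson_iff.1 (Ideal.mul_mem_left _ y (h y)) (-1)
  refine ⟨w * (1 - y * a), ?_⟩
  convert hw using 1
  noncomm_ring

/-- Let `B` be a finitely generated unital associative algebra over a field
of characteristic `≠ 2` satisfying the identity `f_k = 0` for some `k ≥ 1`.  Then `B / J(B)`
is commutative, i.e. every commutator lies in the Jacobson radical `J(B)`. -/
theorem quotient_jacobson_commutative_of_fk_identity
    (F : Type*) [Field F] (hchar : ringChar F ≠ 2)
    (B : Type*) [Ring B] [Algebra F B]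
    (hfg : ∃ S : Finset B, Algebra.adjoin F (↑S : Set B) = ⊤)
    (k : ℕ) (hk : 1 ≤ k)
    (hid : ∀ x : ℕ → B, fk k x = 0) :
    ∀ a b : B, a * b - b * a ∈ Ideal.jacobson (⊥ : Ideal B) := by
  intro a b
  let J := Ideal.jacobson (⊥ : Ideal B)
  let q := Ideal.Quotient.mk J
  have hq (x : B) : q x = 0 ↔ x ∈ J := Ideal.Quotient.eq_zero_iff_mem
  have hsurj : Function.Surjective q := Ideal.Quotient.mk_surjective
  have hprime (a : B ⧸ J) (h : ∀ r, a * r * a = 0) : a = 0 := by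
    obtain ⟨a, rfl⟩ := hsurj a
    refine (hq a).2 (mem_jacobson_bot_of_forall_mul_mul_mem fun r => (hq _).1 ?_)
    simpa using h (q r)
  have htwo (a : B ⧸ J) (h : 2 * a = 0) : a = 0 := by
    have hinv : (algebraMap F B 2⁻¹) * 2 = 1 := by
      rw [← map_ofNat (algebraMap F B) 2, ← map_mul,
        inv_mul_cancel₀ (Ring.two_ne_zero hchar), map_one]
    calc a = q (algebraMap F B 2⁻¹ * 2) * a := by rw [hinv, map_one, one_mul]
      _ = q (algebraMap F B 2⁻¹) * (2 * a) := by rw [map_mul, map_ofNat, mul_assoc]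
      _ = 0 := by rw [h, mul_zero]
  have hidq (x : ℕ → B ⧸ J) : fk k x = 0 := by
    choose y hy using fun j => hsurj (x j)
    rw [← funext hy, ← map_fk q, hid, map_zero]
  refine (hq _).1 ?_
  rw [map_sub, map_mul, map_mul, commute_of_fk_eq_zero hprime htwo hidq, sub_self]
end
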